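/- arXiv:1905.06084 — 6 statements merged into one kernel-verified Lean document; each statement's English description precedes it below -/
import Mathlib

section
/- For every instance of the restricted max-min allocation problem and every target T > 0, if the configuration LP CLP(T) is feasible, then there exists an allocation (D_p)_{p∈P} such that every player p receives resources of total value Σ_{r∈D_p} v_r ≥ (26/99)·T. Consequently, the integrality gap of the configuration LP for the restricted max-min allocation problem is at most 99/26 ≈ 3.808. -/
/-- The configuration LP `CLP(T)` of an instance of the restricted max-min
allocation problem (players `P`, resources `R`, values `v`, desired sets
`Rp`) is feasible: there are nonnegative reals `x p C`, supported on the
configurations of `p` (subsets `C ⊆ Rp p` with `Σ_{r∈C} v r ≥ T`), such that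
every player receives at least one unit of configurations and every resource
is used in at most one unit of configurations. -/
def CLPFeasible {P R : Type*} [Fintype P] [Fintype R] [DecidableEq R]
    (v : R → ℝ) (Rp : P → Finset R) (T : ℝ) : Prop :=
  ∃ x : P → Finset R → ℝ,
    (∀ p C, 0 ≤ x p C) ∧
    (∀ p C, x p C ≠ 0 → C ⊆ Rp p ∧ T ≤ ∑ r ∈ C, v r) ∧
    (∀ p, 1 ≤ ∑ C : Finset R, x p C) ∧
    (∀ r : R, ∑ p : P, ∑ C ∈ Finset.univ.filter (fun C : Finset R => r ∈ C), x p C ≤ 1)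

lemma sum_union_le_sum_add_sum {R : Type*} [DecidableEq R] {f : R → ℝ} (hf : ∀ r, 0 ≤ f r)
    (A B : Finset R) :
    ∑ r ∈ A ∪ B, f r ≤ ∑ r ∈ A, f r + ∑ r ∈ B, f r := by
  rw [← Finset.sum_union_inter]
  exact le_add_of_nonneg_right (Finset.sum_nonneg fun r _ => hf r)

section Matching

variable {P R : Type*} [Fintype P] [DecidableEq R]

/-- A partial matching of the bipartite hypergraph `E`: a player `q` with `M q = ∅` is unmatched. -/
def IsPartialMatching (E : P → Finset R → Prop) (M : P → Finset R) : Prop :=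
  (∀ q, M q = ∅ ∨ E q (M q)) ∧ ∀ p q, p ≠ q → Disjoint (M p) (M q)

/-- The players `X` and resources `U` visited by an alternating search in the partial matching
`M`, where `U` is light with respect to the weight `f`. -/
structure IsSearchState (f : R → ℝ) (Y : ℝ) (M : P → Finset R) (X : Finset P) (U : Finset R) :
    Prop where
  nonempty : X.Nonempty
  subset : ∀ q ∈ X, M q ⊆ U
  disjoint : ∀ q, q ∉ X → Disjoint (M q) U
  sum_le : ∑ r ∈ U, f r ≤ Y * ((X.card : ℝ) - 1)

/-- `M'` is obtained from `M` by giving exactly one player of `X` a new edge avoiding `U`, and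
possibly moving players outside `X` to edges avoiding `U`. -/
def IsExchange (E : P → Finset R → Prop) (M M' : P → Finset R) (X : Finset P) (U : Finset R) :
    Prop :=
  (∃ p ∈ X, E p (M' p) ∧ Disjoint (M' p) U ∧ ∀ q ∈ X, q ≠ p → M' q = M q) ∧
    ∀ q, M' q = M q ∨ (E q (M' q) ∧ Disjoint (M' q) U)

/-- Local search step: in a light search state a player of `X` can be moved to a new edge. -/
lemma exists_isExchange {E : P → Finset R → Prop} {f : R → ℝ} {Y : ℝ} (hf : ∀ r, 0 ≤ f r)
    (hexp : ∀ (X : Finset P) (U : Finset R), X.Nonempty →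
      ∑ r ∈ U, f r ≤ Y * ((X.card : ℝ) - 1) → ∃ p ∈ X, ∃ A, E p A ∧ Disjoint A U)
    (hlight : ∀ p A (B : Finset P) (M : P → Finset R), E p A → B.Nonempty →
      (∀ q ∈ B, E q (M q) ∧ ¬ Disjoint (M q) A) →
      (∀ q q', q ≠ q' → Disjoint (M q) (M q')) →
      ∑ r ∈ A ∪ B.biUnion M, f r ≤ Y * B.card)
    (X : Finset P) (U : Finset R) (M : P → Finset R) (hM : IsPartialMatching E M)
    (hS : IsSearchState f Y M X U) :
    ∃ M', IsPartialMatching E M' ∧ IsExchange E M M' X U := by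
  classical
  induction hn : (Xᶜ).card using Nat.strong_induction_on generalizing X U M with
  | _ n ih =>
  obtain ⟨p, hp, A, hA, hAU⟩ := hexp X U hS.nonempty hS.sum_le
  induction hk : (Finset.univ.filter fun q => ¬ Disjoint (M q) A).card
    using Nat.strong_induction_on generalizing M with
  | _ k ihk =>
  set B := Finset.univ.filter fun q => ¬ Disjoint (M q) A with hB
  have memB : ∀ q, q ∈ B ↔ ¬ Disjoint (M q) A := fun q => by simp [hB]
  have hBX : Disjoint X B := by
    rw [Finset.disjoint_left]
    intro q hq hqB
    exact (memB q).1 hqB (hAU.symm.mono_left (hS.subset q hq))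
  rcases B.eq_empty_or_nonempty with hBe | hBne
  · have hdis : ∀ q, Disjoint (M q) A := by
      intro q
      by_contra h
      have := (memB q).2 h
      simp [hBe] at this
    refine ⟨Function.update M p A, ⟨fun q => ?_, fun q q' hqq => ?_⟩,
      ⟨p, hp, by simpa using hA, by simpa using hAU, fun q _ hq => by simp [hq]⟩, fun q => ?_⟩
    · by_cases h : q = p
      · subst h
        simp [hA]
      · simpa [h] using hM.1 q
    · by_cases h : q = p
      · subst h
        simpa [hqq.symm] using (hdis q').symm
      · by_cases h' : q' = p
        · subst h'
          simpa [h] using hdis q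
        · simpa [h, h'] using hM.2 q q' hqq
    · by_cases h : q = p
      · subst h
        simp [hA, hAU]
      · simp [h]
  have hS' : IsSearchState f Y M (X ∪ B) (U ∪ (A ∪ B.biUnion M)) := by
    refine ⟨hS.nonempty.mono Finset.subset_union_left, fun q hq => ?_, fun q hq => ?_, ?_⟩
    · rcases Finset.mem_union.1 hq with h | h
      · exact (hS.subset q h).trans Finset.subset_union_left
      · exact (Finset.subset_biUnion_of_mem M h).trans
          (Finset.subset_union_right.trans Finset.subset_union_right)
    · rw [Finset.mem_union, not_or] at hq
      rw [Finset.disjoint_union_right, Finset.disjoint_union_right, Finset.disjoint_biUnion_right]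
      refine ⟨hS.disjoint q hq.1, ?_, fun q' hq' => hM.2 q q' ?_⟩
      · by_contra h
        exact hq.2 ((memB q).2 h)
      · rintro rfl
        exact hq.2 hq'
    · have h1 := sum_union_le_sum_add_sum hf U (A ∪ B.biUnion M)
      have h2 := hlight p A B M hA hBne (fun q hq => ⟨(hM.1 q).resolve_left fun h => by
        have := (memB q).1 hq
        simp [h] at this, (memB q).1 hq⟩) hM.2
      rw [Finset.card_union_of_disjoint hBX]
      push_cast
      linarith [hS.sum_le]
  have hlt : ((X ∪ B)ᶜ).card < n := by
    rw [← hn]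
    apply Finset.card_lt_card
    obtain ⟨q, hq⟩ := hBne
    refine Finset.ssubset_iff_of_subset
      (Finset.compl_subset_compl.2 Finset.subset_union_left) |>.2 ⟨q, ?_, ?_⟩
    · simpa using Finset.disjoint_right.1 hBX hq
    · simp [hq]
  obtain ⟨M₁, hM₁, ⟨p₁, hp₁, hE₁, hd₁, hfix₁⟩, hold₁⟩ := ih _ hlt _ _ M hM hS' rfl
  have hold : ∀ q, M₁ q = M q ∨ (E q (M₁ q) ∧ Disjoint (M₁ q) U) := fun q =>
    (hold₁ q).imp_right fun h => ⟨h.1, h.2.mono_right Finset.subset_union_left⟩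
  by_cases hpX : p₁ ∈ X
  · exact ⟨M₁, hM₁, ⟨p₁, hpX, hE₁, hd₁.mono_right Finset.subset_union_left,
      fun q hq => hfix₁ q (Finset.mem_union_left _ hq)⟩, hold⟩
  have hpB : p₁ ∈ B := (Finset.mem_union.1 hp₁).resolve_left hpX
  have hfix : ∀ q ∈ X, M₁ q = M q := fun q hq =>
    hfix₁ q (Finset.mem_union_left _ hq) fun h => hpX (h ▸ hq)
  have hS₁ : IsSearchState f Y M₁ X U := by
    refine ⟨hS.nonempty, fun q hq => hfix q hq ▸ hS.subset q hq, fun q hq => ?_, hS.sum_le⟩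
    rcases hold q with h | h
    · exact h ▸ hS.disjoint q hq
    · exact h.2
  have hA' : A ⊆ U ∪ (A ∪ B.biUnion M) :=
    Finset.subset_union_left.trans Finset.subset_union_right
  have hlt' : (Finset.univ.filter fun q => ¬ Disjoint (M₁ q) A).card < k := by
    rw [← hk]
    apply Finset.card_lt_card
    refine Finset.ssubset_iff_of_subset (fun q hq => ?_) |>.2 ⟨p₁, hpB, ?_⟩
    · have hq' : ¬ Disjoint (M₁ q) A := by simpa using hq
      rcases hold₁ q with h | h
      · exact (memB q).2 (h ▸ hq')
      · exact absurd (h.2.mono_right hA') hq'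
    · simpa using hd₁.mono_right hA'
  obtain ⟨M₂, hM₂, ⟨p₂, hp₂, hE₂, hd₂, hfix₂⟩, hold₂⟩ := ihk _ hlt' M₁ hM₁ hS₁ rfl
  refine ⟨M₂, hM₂, ⟨p₂, hp₂, hE₂, hd₂, fun q hq hne => (hfix₂ q hq hne).trans (hfix q hq)⟩,
    fun q => ?_⟩
  rcases hold₂ q with h | h
  · rw [h]
    exact hold q
  · exact Or.inr h

/-- A weighted Haxell-type condition for perfect matchings in bipartite hypergraphs. -/
theorem exists_perfect_matching {E : P → Finset R → Prop} {f : R → ℝ} {Y : ℝ}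
    (hf : ∀ r, 0 ≤ f r)
    (hexp : ∀ (X : Finset P) (U : Finset R), X.Nonempty →
      ∑ r ∈ U, f r ≤ Y * ((X.card : ℝ) - 1) → ∃ p ∈ X, ∃ A, E p A ∧ Disjoint A U)
    (hlight : ∀ p A (B : Finset P) (M : P → Finset R), E p A → B.Nonempty →
      (∀ q ∈ B, E q (M q) ∧ ¬ Disjoint (M q) A) →
      (∀ q q', q ≠ q' → Disjoint (M q) (M q')) →
      ∑ r ∈ A ∪ B.biUnion M, f r ≤ Y * B.card) :
    ∃ M : P → Finset R, (∀ p, E p (M p)) ∧ ∀ p q, p ≠ q → Disjoint (M p) (M q) := by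
  classical
  suffices h : ∀ n (M : P → Finset R), IsPartialMatching E M →
      (Finset.univ.filter fun q => ¬ E q (M q)).card = n →
      ∃ M : P → Finset R, (∀ p, E p (M p)) ∧ ∀ p q, p ≠ q → Disjoint (M p) (M q) from
    h _ (fun _ => ∅) ⟨fun _ => Or.inl rfl, fun _ _ _ => Finset.disjoint_empty_left _⟩ rfl
  intro n
  induction n using Nat.strong_induction_on with
  | _ n ih =>
  intro M hM hn
  by_cases hall : ∀ p, E p (M p)
  · exact ⟨M, hall, hM.2⟩
  push Not at hall
  obtain ⟨p, hp⟩ := hall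
  have hS : IsSearchState f Y M {p} ∅ :=
    ⟨Finset.singleton_nonempty p, fun q hq => by
      rw [Finset.mem_singleton.1 hq, (hM.1 p).resolve_right hp],
      fun q _ => Finset.disjoint_empty_right _, by simp⟩
  obtain ⟨M', hM', ⟨p', hp', hE', -, -⟩, hold⟩ := exists_isExchange hf hexp hlight _ _ M hM hS
  obtain rfl := Finset.mem_singleton.1 hp'
  refine ih _ ?_ M' hM' rfl
  rw [← hn]
  apply Finset.card_lt_card
  refine Finset.ssubset_iff_of_subset (fun q hq => ?_) |>.2
    ⟨p', by simpa using hp, by simpa using hE'⟩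
  have hq' : ¬ E q (M' q) := by simpa using hq
  rcases hold q with h | h
  · simpa [h] using hq'
  · exact absurd h.1 hq'

end Matching

section Weight

/-- The dual weight of a resource of value `w < 26`. -/
noncomputable def thinWeight (w : ℝ) : ℝ := min (min w 20) (max ((4 * w + 8) / 5) (w - 1))

/-- The dual weight of a resource of value `w`, where edges have value at least `26` and
configurations have value at least `99`. -/
noncomputable def dualWeight (w : ℝ) : ℝ := if 26 ≤ w then 60 else thinWeight w

lemma thinWeight_le_self (w : ℝ) : thinWeight w ≤ w :=
  (min_le_left _ _).trans (min_le_left _ _)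

lemma thinWeight_le_twenty (w : ℝ) : thinWeight w ≤ 20 :=
  (min_le_left _ _).trans (min_le_right _ _)

lemma thinWeight_le_of_le {w : ℝ} (h : w ≤ 13) : thinWeight w ≤ (4 * w + 8) / 5 :=
  (min_le_right _ _).trans (max_le le_rfl (by linarith))

lemma thinWeight_le_of_ge {w : ℝ} (h : 13 ≤ w) : thinWeight w ≤ w - 1 :=
  (min_le_right _ _).trans (max_le (by linarith) le_rfl)

lemma thinWeight_nonneg {w : ℝ} (h : 0 ≤ w) : 0 ≤ thinWeight w :=
  le_min (le_min h (by norm_num)) (le_max_of_le_left (by linarith))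

lemma thinWeight_eq_self {w : ℝ} (h : w ≤ 8) : thinWeight w = w :=
  le_antisymm (thinWeight_le_self w)
    (le_min (le_min le_rfl (by linarith)) (le_max_of_le_left (by linarith)))

lemma thinWeight_eq_of_le {w : ℝ} (h : 8 ≤ w) (h' : w ≤ 13) : thinWeight w = (4 * w + 8) / 5 :=
  le_antisymm (thinWeight_le_of_le h')
    (le_min (le_min (by linarith) (by linarith)) (le_max_left _ _))

lemma thinWeight_eq_of_ge {w : ℝ} (h : 13 ≤ w) (h' : w ≤ 21) : thinWeight w = w - 1 :=
  le_antisymm (thinWeight_le_of_ge h)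
    (le_min (le_min (by linarith) (by linarith)) (le_max_right _ _))

lemma thinWeight_eq_twenty {w : ℝ} (h : 21 ≤ w) : thinWeight w = 20 :=
  le_antisymm (thinWeight_le_twenty w)
    (le_min (le_min (by linarith) le_rfl) (le_max_of_le_right (by linarith)))

lemma thinWeight_ge_of_le {w : ℝ} (h : 0 ≤ w) (h' : w ≤ 21) : 12 / 13 * w ≤ thinWeight w := by
  refine le_min (le_min (by linarith) (by linarith)) ?_
  rcases le_total w 13 with h1 | h1
  · exact le_max_of_le_left (by linarith)
  · exact le_max_of_le_right (by linarith)

lemma thinWeight_add_le {a b : ℝ} (ha : 0 ≤ a) (hb : 0 ≤ b) :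
    thinWeight (a + b) ≤ thinWeight a + thinWeight b := by
  have piecewise : ∀ w : ℝ, (w ≤ 8 ∧ thinWeight w = w) ∨
      (8 ≤ w ∧ w ≤ 13 ∧ thinWeight w = (4 * w + 8) / 5) ∨
      (13 ≤ w ∧ w ≤ 21 ∧ thinWeight w = w - 1) ∨ (21 ≤ w ∧ thinWeight w = 20) := by
    intro w
    rcases le_total w 8 with h1 | h1
    · exact Or.inl ⟨h1, thinWeight_eq_self h1⟩
    rcases le_total w 13 with h2 | h2
    · exact Or.inr (Or.inl ⟨h1, h2, thinWeight_eq_of_le h1 h2⟩)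
    rcases le_total w 21 with h3 | h3
    · exact Or.inr (Or.inr (Or.inl ⟨h2, h3, thinWeight_eq_of_ge h2 h3⟩))
    · exact Or.inr (Or.inr (Or.inr ⟨h3, thinWeight_eq_twenty h3⟩))
  have h1 := thinWeight_le_self (a + b)
  have h2 := thinWeight_le_twenty (a + b)
  have h3 : thinWeight (a + b) ≤ (4 * (a + b) + 8) / 5 ∨ thinWeight (a + b) ≤ a + b - 1 ∧
      13 ≤ a + b := (le_total (a + b) 13).imp thinWeight_le_of_le
        fun h => ⟨thinWeight_le_of_ge h, h⟩
  rcases piecewise a with ⟨ha1, ha⟩ | ⟨ha1, ha2, ha⟩ | ⟨ha1, ha2, ha⟩ | ⟨ha1, ha⟩ <;>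
    rcases piecewise b with ⟨hb1, hb⟩ | ⟨hb1, hb2, hb⟩ | ⟨hb1, hb2, hb⟩ | ⟨hb1, hb⟩ <;>
    rcases h3 with h3 | ⟨h3, h4⟩ <;> rw [ha, hb] <;> linarith

lemma twenty_le_sum_thinWeight {ι : Type*} {S : Finset ι} {w : ι → ℝ} (h0 : ∀ i ∈ S, 0 ≤ w i)
    (hS : 21 ≤ ∑ i ∈ S, w i) : 20 ≤ ∑ i ∈ S, thinWeight (w i) := by
  classical
  have key : ∀ T ⊆ S, thinWeight (∑ i ∈ T, w i) ≤ ∑ i ∈ T, thinWeight (w i) := by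
    intro T
    induction T using Finset.induction_on with
    | empty => simpa using thinWeight_le_self 0
    | insert a T ha ih =>
      intro hT
      rw [Finset.sum_insert ha, Finset.sum_insert ha]
      have hT' := (Finset.subset_insert a T).trans hT
      exact (thinWeight_add_le (h0 a (hT (Finset.mem_insert_self a T)))
        (Finset.sum_nonneg fun i hi => h0 i (hT' hi))).trans (by linarith [ih hT'])
  rw [← thinWeight_eq_twenty hS]
  exact key S subset_rfl

/-- Thin resources of total value more than `73` have weight at least `60`. -/
lemma sixty_le_sum_thinWeight {ι : Type*} {S : Finset ι} {w : ι → ℝ} (h0 : ∀ i ∈ S, 0 ≤ w i)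
    (h26 : ∀ i ∈ S, w i ≤ 26) (hS : 73 ≤ ∑ i ∈ S, w i) : 60 ≤ ∑ i ∈ S, thinWeight (w i) := by
  classical
  rw [← Finset.sum_filter_add_sum_filter_not S (fun i => 21 ≤ w i)] at hS ⊢
  set L := S.filter fun i => 21 ≤ w i
  set D := S.filter fun i => ¬ 21 ≤ w i
  have hL : ∑ i ∈ L, thinWeight (w i) = 20 * L.card := by
    rw [Finset.sum_congr rfl fun i hi => thinWeight_eq_twenty (Finset.mem_filter.1 hi).2]
    rw [Finset.sum_const, nsmul_eq_mul, mul_comm]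
  have hL' : ∑ i ∈ L, w i ≤ 26 * L.card := by
    have := Finset.sum_le_card_nsmul L w 26 fun i hi => h26 i (Finset.mem_filter.1 hi).1
    rw [nsmul_eq_mul] at this
    linarith
  have hD0 : ∀ i ∈ D, 0 ≤ w i := fun i hi => h0 i (Finset.mem_filter.1 hi).1
  have hD : 12 / 13 * ∑ i ∈ D, w i ≤ ∑ i ∈ D, thinWeight (w i) := by
    rw [Finset.mul_sum]
    exact Finset.sum_le_sum fun i hi =>
      thinWeight_ge_of_le (hD0 i hi) (not_le.1 (Finset.mem_filter.1 hi).2).le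
  have hDn : 0 ≤ ∑ i ∈ D, thinWeight (w i) :=
    Finset.sum_nonneg fun i hi => thinWeight_nonneg (hD0 i hi)
  rw [hL]
  rcases Nat.lt_or_ge L.card 3 with hc | hc
  · interval_cases h : L.card
    · norm_num at hL' ⊢
      linarith
    · norm_num at hL' ⊢
      linarith
    · have := twenty_le_sum_thinWeight hD0 (by norm_num at hL'; linarith)
      norm_num
      linarith
  · have : (3 : ℝ) ≤ L.card := by exact_mod_cast hc
    linarith

lemma half_thinWeight_add_le {x a b : ℝ} (hxa : x + a ≤ 26) (hxb : x + b ≤ 26)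
    (hab : a + b ≤ 26) : thinWeight x / 2 + (thinWeight a + thinWeight b) ≤ 30 := by
  rcases le_total x 13 with hx | hx <;> rcases le_total a 13 with ha | ha <;>
    rcases le_total b 13 with hb | hb <;>
    first
    | linarith [thinWeight_le_of_le hx, thinWeight_le_of_le ha, thinWeight_le_of_le hb]
    | linarith [thinWeight_le_of_le hx, thinWeight_le_of_ge ha, thinWeight_le_of_le hb]
    | linarith [thinWeight_le_of_le hx, thinWeight_le_of_le ha, thinWeight_le_of_ge hb]
    | linarith [thinWeight_le_of_ge hx, thinWeight_le_of_le ha, thinWeight_le_of_le hb]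
    | linarith [thinWeight_le_of_le hx, thinWeight_le_of_ge ha, thinWeight_le_of_ge hb]
    | linarith [thinWeight_le_of_ge hx, thinWeight_le_of_ge ha, thinWeight_le_of_le hb]
    | linarith [thinWeight_le_of_ge hx, thinWeight_le_of_le ha, thinWeight_le_of_ge hb]
    | linarith [thinWeight_le_of_ge hx, thinWeight_le_of_ge ha, thinWeight_le_of_ge hb]

lemma thinWeight_le_sub_of_ten_le {w : ℝ} (h : 10 ≤ w) : thinWeight w ≤ w - 2 / 5 := by
  rcases le_total w 13 with h1 | h1
  · linarith [thinWeight_le_of_le h1]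
  · linarith [thinWeight_le_of_ge h1]

lemma half_thinWeight_add_add_le {x a b c : ℝ} (ha : x + (b + c) ≤ 26) (hb : x + (a + c) ≤ 26)
    (hc : x + (a + b) ≤ 26) (habc : a + b + c ≤ 26) :
    thinWeight x / 2 + (thinWeight a + (thinWeight b + thinWeight c)) ≤ 30 := by
  have tx := thinWeight_le_self x
  have ta := thinWeight_le_self a
  have tb := thinWeight_le_self b
  have tc := thinWeight_le_self c
  rcases le_total 10 x with hx | hx
  · linarith
  rcases le_total 10 a with ha' | ha'
  · linarith [thinWeight_le_sub_of_ten_le ha']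
  rcases le_total 10 b with hb' | hb'
  · linarith [thinWeight_le_sub_of_ten_le hb']
  rcases le_total 10 c with hc' | hc'
  · linarith [thinWeight_le_sub_of_ten_le hc']
  linarith [thinWeight_le_of_le (show x ≤ 13 by linarith),
    thinWeight_le_of_le (show a ≤ 13 by linarith), thinWeight_le_of_le (show b ≤ 13 by linarith),
    thinWeight_le_of_le (show c ≤ 13 by linarith)]

variable {R : Type*} [DecidableEq R]

/-- `A` is a minimal set of resources of total value at least `26`. -/
def IsMinimalEdge (w : R → ℝ) (A : Finset R) : Prop :=
  26 ≤ ∑ r ∈ A, w r ∧ ∀ r ∈ A, ∑ s ∈ A.erase r, w s < 26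

lemma exists_isMinimalEdge_subset {w : R → ℝ} (S : Finset R) (hS : 26 ≤ ∑ r ∈ S, w r) :
    ∃ A ⊆ S, IsMinimalEdge w A := by
  induction S using Finset.strongInduction with
  | _ S ih =>
  by_cases h : ∀ r ∈ S, ∑ s ∈ S.erase r, w s < 26
  · exact ⟨S, subset_rfl, hS, h⟩
  · push Not at h
    obtain ⟨r, hr, hle⟩ := h
    obtain ⟨A, hA, hmin⟩ := ih _ (Finset.erase_ssubset hr) hle
    exact ⟨A, hA.trans (Finset.erase_subset r S), hmin⟩

lemma IsMinimalEdge.eq_singleton {w : R → ℝ} (hw : ∀ r, 0 ≤ w r) {A : Finset R}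
    (hA : IsMinimalEdge w A) {r : R} (hr : r ∈ A) (hfat : 26 ≤ w r) : A = {r} := by
  refine Finset.eq_singleton_iff_unique_mem.2 ⟨hr, fun s hs => ?_⟩
  by_contra hne
  have h1 := hA.2 s hs
  have h2 := Finset.single_le_sum (fun i _ => hw i)
    (Finset.mem_erase.2 ⟨fun h => hne h.symm, hr⟩ : r ∈ A.erase s)
  linarith

/-- Weight bounds for a thin minimal edge `A` with a distinguished resource `x`. -/
lemma IsMinimalEdge.sum_thinWeight_erase_le {w : R → ℝ} (hw : ∀ r, 0 ≤ w r) {A : Finset R}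
    (hA : IsMinimalEdge w A) {x : R} (hx : x ∈ A) :
    ∑ r ∈ A.erase x, thinWeight (w r) ≤ 20 ∨
      (thinWeight (w x) + ∑ r ∈ A.erase x, thinWeight (w r) ≤ 40 ∧
        thinWeight (w x) / 2 + ∑ r ∈ A.erase x, thinWeight (w r) ≤ 30) := by
  set D := A.erase x with hD
  have hW : ∑ r ∈ D, w r < 26 := hA.2 x hx
  have hsum : ∀ d ∈ D, w x + ∑ r ∈ D.erase d, w r < 26 := by
    intro d hd
    have hdx : d ≠ x := (Finset.mem_erase.1 hd).1
    have h := hA.2 d (Finset.mem_erase.1 hd).2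
    rw [← Finset.add_sum_erase _ _ (Finset.mem_erase.2 ⟨hdx.symm, hx⟩),
      Finset.erase_right_comm] at h
    exact h
  have hle : ∑ r ∈ D, thinWeight (w r) ≤ ∑ r ∈ D, w r :=
    Finset.sum_le_sum fun r _ => thinWeight_le_self _
  have hx' := thinWeight_le_self (w x)
  have hW0 : 0 ≤ ∑ r ∈ D, w r := Finset.sum_nonneg fun r _ => hw r
  have havg : (D.card : ℝ) * (w x + ∑ r ∈ D, w r) - ∑ r ∈ D, w r ≤ D.card * 26 := by
    have h : ∑ d ∈ D, (w x + ∑ r ∈ D, w r - w d) ≤ ∑ d ∈ D, (26 : ℝ) :=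
      Finset.sum_le_sum fun d hd => by
        have := Finset.add_sum_erase D w hd
        linarith [hsum d hd]
    rw [Finset.sum_sub_distrib, Finset.sum_const, Finset.sum_const, nsmul_eq_mul,
      nsmul_eq_mul] at h
    exact h
  have hmul : ∀ m : ℝ, 0 < m → m ≤ D.card →
      w x + ∑ r ∈ D, w r - (∑ r ∈ D, w r) / m ≤ 26 := by
    intro m hm hmD
    have hpos : (0 : ℝ) < D.card := hm.trans_le hmD
    have h1 : (∑ r ∈ D, w r) / D.card ≤ (∑ r ∈ D, w r) / m := by gcongr
    have h2 : w x + ∑ r ∈ D, w r - (∑ r ∈ D, w r) / D.card ≤ 26 := by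
      have : w x + ∑ r ∈ D, w r - (∑ r ∈ D, w r) / D.card =
          ((D.card : ℝ) * (w x + ∑ r ∈ D, w r) - ∑ r ∈ D, w r) / D.card := by
        field_simp
      rw [this, div_le_iff₀ hpos]
      linarith
    linarith
  rcases Nat.lt_or_ge D.card 2 with hc | hc
  · left
    have := Finset.sum_le_card_nsmul D (fun r => thinWeight (w r)) 20
      fun r _ => thinWeight_le_twenty _
    rw [nsmul_eq_mul] at this
    have h1 : (D.card : ℝ) ≤ 1 := by exact_mod_cast Nat.lt_succ_iff.1 hc
    linarith
  right
  refine ⟨by linarith [hmul 2 (by norm_num) (by exact_mod_cast hc)], ?_⟩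
  rcases Nat.lt_or_ge D.card 4 with hc4 | hc4
  · obtain h2 | h3 : D.card = 2 ∨ D.card = 3 := by omega
    · obtain ⟨a, b, hab, hDab⟩ := Finset.card_eq_two.1 h2
      have ha := hsum a (by simp [hDab])
      have hb := hsum b (by simp [hDab])
      rw [hDab] at ha hb hW ⊢
      rw [Finset.sum_pair hab] at hW ⊢
      have e1 : ({a, b} : Finset R).erase a = {b} := by grind
      have e2 : ({a, b} : Finset R).erase b = {a} := by grind
      rw [e1, Finset.sum_singleton] at ha
      rw [e2, Finset.sum_singleton] at hb
      exact half_thinWeight_add_le hb.le ha.le hW.le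
    · obtain ⟨a, b, c, hab, hac, hbc, hDabc⟩ := Finset.card_eq_three.1 h3
      have ha := hsum a (by simp [hDabc])
      have hb := hsum b (by simp [hDabc])
      have hc := hsum c (by simp [hDabc])
      rw [hDabc] at ha hb hc hW ⊢
      have e0 : ∀ f : R → ℝ, ∑ r ∈ ({a, b, c} : Finset R), f r = f a + (f b + f c) := by
        intro f
        rw [Finset.sum_insert (by simp [hab, hac]), Finset.sum_pair hbc]
      have e1 : ({a, b, c} : Finset R).erase a = {b, c} := by grind
      have e2 : ({a, b, c} : Finset R).erase b = {a, c} := by grind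
      have e3 : ({a, b, c} : Finset R).erase c = {a, b} := by grind
      rw [e1, Finset.sum_pair hbc] at ha
      rw [e2, Finset.sum_pair hac] at hb
      rw [e3, Finset.sum_pair hab] at hc
      rw [e0] at hW ⊢
      exact half_thinWeight_add_add_le ha.le hb.le hc.le (by linarith)
  · linarith [hmul 4 (by norm_num) (by exact_mod_cast hc4)]

lemma IsMinimalEdge.sum_thinWeight_le {w : R → ℝ} (hw : ∀ r, 0 ≤ w r) {A : Finset R}
    (hA : IsMinimalEdge w A) {x : R} (hx : x ∈ A) : ∑ r ∈ A, thinWeight (w r) ≤ 40 := by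
  rw [← Finset.add_sum_erase _ _ hx]
  rcases hA.sum_thinWeight_erase_le hw hx with h | h
  · linarith [thinWeight_le_twenty (w x)]
  · exact h.1

lemma IsMinimalEdge.sum_thinWeight_union_le {w : R → ℝ} (hw : ∀ r, 0 ≤ w r) {A B : Finset R}
    (hA : IsMinimalEdge w A) (hB : IsMinimalEdge w B) {x : R} (hxA : x ∈ A) (hxB : x ∈ B) :
    ∑ r ∈ A ∪ B, thinWeight (w r) ≤ 60 := by
  have hsub := sum_union_le_sum_add_sum (fun r => thinWeight_nonneg (hw r)) (A.erase x) B
  have heq : A ∪ B = A.erase x ∪ B := by grind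
  rw [heq]
  rw [← Finset.add_sum_erase B _ hxB] at hsub
  rcases hA.sum_thinWeight_erase_le hw hxA with h | h <;>
    rcases hB.sum_thinWeight_erase_le hw hxB with h' | h' <;>
    linarith [thinWeight_le_twenty (w x)]

lemma dualWeight_nonneg {w : ℝ} (h : 0 ≤ w) : 0 ≤ dualWeight w := by
  unfold dualWeight
  split_ifs
  · norm_num
  · exact thinWeight_nonneg h

/-- An edge together with the matched edges it meets is light. -/
lemma sum_dualWeight_union_biUnion_le {P : Type*} {w : R → ℝ} (hw : ∀ r, 0 ≤ w r) {A : Finset R}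
    (hA : IsMinimalEdge w A) {B : Finset P} (hBne : B.Nonempty) {M : P → Finset R}
    (hB : ∀ q ∈ B, IsMinimalEdge w (M q) ∧ ¬ Disjoint (M q) A)
    (hdis : ∀ q q', q ≠ q' → Disjoint (M q) (M q')) :
    ∑ r ∈ A ∪ B.biUnion M, dualWeight (w r) ≤ 60 * B.card := by
  classical
  have hcard : (1 : ℝ) ≤ B.card := by exact_mod_cast hBne.card_pos
  by_cases hfat : ∃ r ∈ A, 26 ≤ w r
  · obtain ⟨r, hr, hr26⟩ := hfat
    have hAr := hA.eq_singleton hw hr hr26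
    have hM : ∀ q ∈ B, M q = {r} := by
      intro q hq
      obtain ⟨s, hs, hsA⟩ := Finset.not_disjoint_iff.1 (hB q hq).2
      rw [hAr, Finset.mem_singleton] at hsA
      exact (hB q hq).1.eq_singleton hw (hsA ▸ hs) hr26
    have hU : A ∪ B.biUnion M ⊆ {r} := by
      rw [hAr]
      exact Finset.union_subset subset_rfl (Finset.biUnion_subset.2 fun q hq => (hM q hq).subset)
    calc ∑ r ∈ A ∪ B.biUnion M, dualWeight (w r) ≤ ∑ s ∈ {r}, dualWeight (w s) :=
          Finset.sum_le_sum_of_subset_of_nonneg hU fun s _ _ => dualWeight_nonneg (hw s)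
      _ = 60 := by simp [dualWeight, hr26]
      _ ≤ 60 * B.card := by linarith
  push Not at hfat
  have hthin : ∀ r ∈ A ∪ B.biUnion M, dualWeight (w r) = thinWeight (w r) := by
    intro r hr
    refine if_neg fun h26 => ?_
    rcases Finset.mem_union.1 hr with h | h
    · exact absurd (hfat r h) (not_lt.2 h26)
    · obtain ⟨q, hq, hrq⟩ := Finset.mem_biUnion.1 h
      obtain ⟨s, hs, hsA⟩ := Finset.not_disjoint_iff.1 (hB q hq).2
      rw [(hB q hq).1.eq_singleton hw hrq h26, Finset.mem_singleton] at hs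
      exact absurd (hfat r (hs ▸ hsA)) (not_lt.2 h26)
  rw [Finset.sum_congr rfl hthin]
  rcases Nat.lt_or_ge B.card 2 with hc | hc
  · have h1 : B.card = 1 := by have := hBne.card_pos; omega
    obtain ⟨q, rfl⟩ := Finset.card_eq_one.1 h1
    have hq := hB q (Finset.mem_singleton_self q)
    obtain ⟨s, hs, hsA⟩ := Finset.not_disjoint_iff.1 hq.2
    simpa using hA.sum_thinWeight_union_le hw hq.1 hsA hs
  · obtain ⟨q, hq⟩ := hBne
    obtain ⟨s, hs, hsA⟩ := Finset.not_disjoint_iff.1 (hB q hq).2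
    have heq : A ∪ B.biUnion M = A.erase s ∪ B.biUnion M := by
      have : s ∈ B.biUnion M := Finset.mem_biUnion.2 ⟨q, hq, hs⟩
      grind
    have h1 := sum_union_le_sum_add_sum (fun r => thinWeight_nonneg (hw r)) (A.erase s)
      (B.biUnion M)
    have h2 : ∑ r ∈ A.erase s, thinWeight (w r) ≤ ∑ r ∈ A.erase s, w r :=
      Finset.sum_le_sum fun r _ => thinWeight_le_self _
    have h3 : ∑ r ∈ B.biUnion M, thinWeight (w r) ≤ 40 * B.card := by
      rw [Finset.sum_biUnion fun q _ q' _ h => hdis q q' h]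
      have := Finset.sum_le_card_nsmul B (fun q => ∑ r ∈ M q, thinWeight (w r)) 40 fun q hq => by
        obtain ⟨s, hs, -⟩ := Finset.not_disjoint_iff.1 (hB q hq).2
        exact (hB q hq).1.sum_thinWeight_le hw hs
      rw [nsmul_eq_mul] at this
      linarith
    have h4 : (2 : ℝ) ≤ B.card := by exact_mod_cast hc
    rw [heq]
    linarith [hA.2 s hsA]

end Weight

/-- Weak duality: a weight `f` on `U` covering the configurations of every player in `X` has
total at least `Y * |X|`. -/
lemma CLPFeasible.mul_card_le_sum {P R : Type*} [Fintype P] [Fintype R] [DecidableEq R]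
    {v : R → ℝ} {Rp : P → Finset R} {T : ℝ} (hfeas : CLPFeasible v Rp T) {f : R → ℝ}
    (hf : ∀ r, 0 ≤ f r) {Y : ℝ} (hY : 0 ≤ Y) (X : Finset P) (U : Finset R)
    (hcov : ∀ p ∈ X, ∀ C ⊆ Rp p, T ≤ ∑ r ∈ C, v r → Y ≤ ∑ r ∈ C ∩ U, f r) :
    Y * X.card ≤ ∑ r ∈ U, f r := by
  obtain ⟨x, hx0, hxC, hxp, hxr⟩ := hfeas
  calc Y * X.card = ∑ p ∈ X, Y := by simp [mul_comm]
    _ ≤ ∑ p ∈ X, ∑ C : Finset R, x p C * Y := Finset.sum_le_sum fun p _ => by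
        rw [← Finset.sum_mul]
        exact le_mul_of_one_le_left hY (hxp p)
    _ ≤ ∑ p ∈ X, ∑ C : Finset R, x p C * ∑ r ∈ C ∩ U, f r :=
        Finset.sum_le_sum fun p hp => Finset.sum_le_sum fun C _ => by
          by_cases h : x p C = 0
          · simp [h]
          · exact mul_le_mul_of_nonneg_left (hcov p hp C (hxC p C h).1 (hxC p C h).2) (hx0 p C)
    _ ≤ ∑ p : P, ∑ C : Finset R, x p C * ∑ r ∈ C ∩ U, f r :=
        Finset.sum_le_sum_of_subset_of_nonneg (Finset.subset_univ X) fun p _ _ =>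
          Finset.sum_nonneg fun C _ => mul_nonneg (hx0 p C) (Finset.sum_nonneg fun r _ => hf r)
    _ = ∑ p : P, ∑ C : Finset R, ∑ r ∈ U, if r ∈ C then x p C * f r else 0 := by
        refine Finset.sum_congr rfl fun p _ => Finset.sum_congr rfl fun C _ => ?_
        rw [Finset.mul_sum, ← Finset.sum_filter, Finset.inter_comm, Finset.filter_mem_eq_inter]
    _ = ∑ r ∈ U, ∑ p : P, ∑ C : Finset R, if r ∈ C then x p C * f r else 0 := by
        rw [Finset.sum_comm (s := U)]
        exact Finset.sum_congr rfl fun p _ => Finset.sum_comm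
    _ = ∑ r ∈ U, (∑ p : P, ∑ C ∈ Finset.univ.filter (fun C : Finset R => r ∈ C), x p C) * f r := by
        refine Finset.sum_congr rfl fun r _ => ?_
        simp_rw [Finset.sum_mul, Finset.sum_filter]
    _ ≤ ∑ r ∈ U, f r := Finset.sum_le_sum fun r _ => mul_le_of_le_one_left (hf r) (hxr r)

/-- **Integrality gap of the configuration LP is at most `99/26 ≈ 3.808`.**
For every instance of the restricted max-min allocation problem and every
target `T > 0`, if `CLP(T)` is feasible then there is an allocation
`(D p)_{p ∈ P}` (pairwise disjoint sets of desired resources) in which every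
player receives at least `(26/99)·T` worth of resources. -/
theorem integrality_gap {P R : Type*} [Fintype P] [Fintype R] [DecidableEq R]
    (v : R → ℝ) (hv : ∀ r, 0 ≤ v r) (Rp : P → Finset R)
    (T : ℝ) (hT : 0 < T) (hfeas : CLPFeasible v Rp T) :
    ∃ D : P → Finset R,
      (∀ p, D p ⊆ Rp p) ∧
      (∀ p q, p ≠ q → Disjoint (D p) (D q)) ∧
      (∀ p, (26 / 99) * T ≤ ∑ r ∈ D p, v r) := by
  set w : R → ℝ := fun r => 99 / T * v r
  have hc : 0 < 99 / T := by positivity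
  have hw : ∀ r, 0 ≤ w r := fun r => mul_nonneg hc.le (hv r)
  have hsum : ∀ S : Finset R, ∑ r ∈ S, w r = 99 / T * ∑ r ∈ S, v r := fun S => by
    rw [Finset.mul_sum]
  have hf : ∀ r, 0 ≤ dualWeight (w r) := fun r => dualWeight_nonneg (hw r)
  obtain ⟨M, hM, hdis⟩ := exists_perfect_matching (Y := 60)
    (E := fun p A => A ⊆ Rp p ∧ IsMinimalEdge w A) hf
    (fun X U _ hU => by
      by_contra! hno
      have := hfeas.mul_card_le_sum hf (Y := 60) (by norm_num) X U fun p hp C hC hCT => ?_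
      · linarith
      have hC99 : 99 ≤ ∑ r ∈ C, w r := by
        rw [hsum, div_mul_eq_mul_div, le_div_iff₀ hT]
        linarith
      have hout : ∑ r ∈ C \ U, w r < 26 := by
        by_contra! h
        obtain ⟨A, hA, hmin⟩ := exists_isMinimalEdge_subset _ h
        exact hno p hp A ⟨hA.trans (Finset.sdiff_subset.trans hC), hmin⟩
          (Finset.sdiff_disjoint.mono_left hA)
      have hin := Finset.sum_inter_add_sum_sdiff C U w
      by_cases hfat : ∃ r ∈ C ∩ U, 26 ≤ w r
      · obtain ⟨r, hr, h26⟩ := hfat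
        have := Finset.single_le_sum (fun i _ => hf i) hr
        simpa [dualWeight, h26] using this
      · push Not at hfat
        have hthin : ∀ r ∈ C ∩ U, dualWeight (w r) = thinWeight (w r) := fun r hr =>
          if_neg (not_le.2 (hfat r hr))
        rw [Finset.sum_congr rfl hthin]
        exact sixty_le_sum_thinWeight (fun r _ => hw r) (fun r hr => (hfat r hr).le)
          (by linarith))
    (fun p A B M hA hBne hB hdis => sum_dualWeight_union_biUnion_le hw hA.2 hBne
      (fun q hq => ⟨(hB q hq).1.2, (hB q hq).2⟩) hdis)
  refine ⟨M, fun p => (hM p).1, hdis, fun p => ?_⟩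
  have h := (hM p).2.1
  rw [hsum, div_mul_eq_mul_div, le_div_iff₀ hT] at h
  linarith
end

section
/- Let λ > 0 and β ≥ 0 be reals, let R be a finite set with nonnegative values v_r for r ∈ R, and write v[S] = Σ_{r∈S} v_r for S ⊆ R. Let a_1, …, a_k (k ≥ 1) be a sequence of subsets of R and let b ⊆ R. Suppose that for every j ∈ {1,…,k}, if v[b ∩ (a_1 ∪ ⋯ ∪ a_{j−1})] > βλ then b ∩ a_j = ∅. Then there exists an index j ∈ {1,…,k} such that v[b ∩ ⋃_{i≠j} a_i] ≤ βλ. (This is the abstract content of the limited-blocking lemma: each blocking edge b shares at most βλ worth of resources with all but one of the addable edges of its layer.) -/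
/-- **Limited blocking lemma (abstract form).**
`R` is a finite set of resources with nonnegative values `v`.  `a 1, …, a k`
are the resource sets of the addable edges of a layer in chronological order,
`b` is the resource set of a blocking edge.  If, whenever `b` shares more than
`β·λ` worth of resources with the previously added addable edges, `b` is
disjoint from the next addable edge, then there is an index `j` such that `b`
shares at most `β·λ` worth of resources with all the addable edges other
than `a j`. -/
theorem limited_blocking {R : Type*} [Fintype R] [DecidableEq R]
    (v : R → ℝ) (hv : ∀ r, 0 ≤ v r)
    (lam beta : ℝ) (hlam : 0 < lam) (hbeta : 0 ≤ beta)
    (k : ℕ) (hk : 1 ≤ k) (a : Fin k → Finset R) (b : Finset R)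
    (h : ∀ j : Fin k,
      beta * lam < ∑ r ∈ b ∩ (Finset.univ.filter (fun i => i < j)).biUnion a, v r →
      b ∩ a j = ∅) :
    ∃ j : Fin k,
      ∑ r ∈ b ∩ (Finset.univ.filter (fun i => i ≠ j)).biUnion a, v r ≤ beta * lam := by
  let s : Finset (Fin k) := Finset.univ.filter fun j =>
    ∑ r ∈ b ∩ (Finset.univ.filter (fun i => i < j)).biUnion a, v r ≤ beta * lam
  have hs : s.Nonempty := by
    refine ⟨⟨0, hk⟩, Finset.mem_filter.2 ⟨Finset.mem_univ _, ?_⟩⟩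
    have h_empty : Finset.univ.filter (fun i : Fin k => i < ⟨0, hk⟩) = ∅ :=
      Finset.filter_eq_empty_iff.2 fun i _ hi => Nat.not_lt_zero _ (Fin.lt_def.1 hi)
    rw [h_empty]
    simpa using mul_nonneg hbeta hlam.le
  obtain ⟨j, hj, hmax⟩ := s.exists_max_image id hs
  refine ⟨j, le_trans (Finset.sum_le_sum_of_subset_of_nonneg ?_ fun r _ _ => hv r)
    (Finset.mem_filter.1 hj).2⟩
  intro r hr
  simp only [Finset.mem_inter, Finset.mem_biUnion, Finset.mem_filter, Finset.mem_univ,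
    true_and] at hr ⊢
  obtain ⟨hrb, i, hij, hri⟩ := hr
  refine ⟨hrb, i, lt_of_le_of_ne (not_lt.1 fun hji => ?_) hij, hri⟩
  have hi : b ∩ a i = ∅ := h i <| not_le.1 fun hle =>
    not_le.2 hji (hmax i (Finset.mem_filter.2 ⟨Finset.mem_univ _, hle⟩))
  exact Finset.notMem_empty r (hi ▸ Finset.mem_inter.2 ⟨hrb, hri⟩)
end

section
/- Let λ > 0, β > 0, γ > 0 be reals, let R be a finite set with nonnegative values v_r for r ∈ R, and write v[S] = Σ_{r∈S} v_r. Let 𝒜 be a finite family of pairwise disjoint subsets of R and let ℬ be a nonempty finite family of subsets of R. Suppose that (i) for every a ∈ 𝒜, v[a ∩ ⋃ℬ] > γλ, and (ii) for every b ∈ ℬ there exists a_b ∈ 𝒜 with v[b ∩ ⋃(𝒜 ∖ {a_b})] ≤ βλ. Then |𝒜| < (1 + β/γ)·|ℬ|. -/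
/-- The sum of a nonnegative function over a union is at most the sum of its sums over the pieces. -/
theorem sum_biUnion_le_sum_sum {ι R : Type*} [DecidableEq R] (v : R → ℝ) (hv : ∀ r, 0 ≤ v r)
    (s : Finset ι) (t : ι → Finset R) :
    ∑ r ∈ s.biUnion t, v r ≤ ∑ i ∈ s, ∑ r ∈ t i, v r := by
  classical
  induction s using Finset.induction_on with
  | empty => simp
  | insert a s ha ih =>
    rw [Finset.biUnion_insert, Finset.sum_insert ha]
    have hunion := Finset.sum_union_inter (s₁ := t a) (s₂ := s.biUnion t) (f := v)
    have hinter : 0 ≤ ∑ r ∈ t a ∩ s.biUnion t, v r := Finset.sum_nonneg fun r _ => hv r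
    linarith


/-- **Lemma (number of addable edges versus blocking edges).**
`A 1, …, A m` are the (pairwise disjoint) resource sets of the addable edges of
a layer and `B 1, …, B n` are the resource sets of its blocking edges
(`n ≥ 1`).  If every addable edge shares more than `γ·λ` worth of resources
with the blocking edges, and every blocking edge shares at most `β·λ` worth of
resources with all but one of the addable edges, then `m < (1 + β/γ)·n`. -/
theorem addable_lt_blocking {R : Type*} [Fintype R] [DecidableEq R]
    (v : R → ℝ) (hv : ∀ r, 0 ≤ v r)
    (lam beta gamma : ℝ) (hlam : 0 < lam) (hbeta : 0 < beta) (hgamma : 0 < gamma)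
    (m n : ℕ) (hn : 1 ≤ n)
    (A : Fin m → Finset R) (B : Fin n → Finset R)
    (hAdisj : ∀ i j : Fin m, i ≠ j → Disjoint (A i) (A j))
    (hblocked : ∀ i : Fin m,
      gamma * lam < ∑ r ∈ A i ∩ Finset.univ.biUnion B, v r)
    (hlimited : ∀ j : Fin n, ∃ i : Fin m,
      ∑ r ∈ B j ∩ (Finset.univ.erase i).biUnion A, v r ≤ beta * lam) :
    (m : ℝ) < (1 + beta / gamma) * n := by
  choose f hf using hlimited
  set I : Finset (Fin m) := Finset.univ.image f
  have hIcard : (I.card : ℝ) ≤ n := by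
    have h : I.card ≤ n := by simpa using Finset.card_image_le (s := Finset.univ) (f := f)
    exact_mod_cast h
  have hcard : (I.card : ℝ) + (Iᶜ).card = m := by
    have h : I.card + (Iᶜ).card = m := by simp
    exact_mod_cast h
  have hn' : (0 : ℝ) < n := by exact_mod_cast hn
  have hcover (i : Fin m) :
      ∑ r ∈ A i ∩ Finset.univ.biUnion B, v r ≤ ∑ j, ∑ r ∈ B j ∩ A i, v r := by
    rw [Finset.inter_comm, Finset.biUnion_inter]
    exact sum_biUnion_le_sum_sum v hv _ _
  have hpack (j : Fin n) : ∑ i ∈ Iᶜ, ∑ r ∈ B j ∩ A i, v r ≤ beta * lam := by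
    rw [← Finset.sum_biUnion fun i _ k _ hik =>
      (hAdisj i k hik).mono Finset.inter_subset_right Finset.inter_subset_right]
    refine le_trans (Finset.sum_le_sum_of_subset_of_nonneg ?_ fun r _ _ => hv r) (hf j)
    rw [← Finset.inter_biUnion]
    refine Finset.inter_subset_inter_left (Finset.biUnion_subset_biUnion_of_subset_left A ?_)
    intro i hi
    have hne : i ≠ f j := by
      rintro rfl
      exact Finset.mem_compl.mp hi (Finset.mem_image_of_mem f (Finset.mem_univ j))
    simpa using hne
  have hupper : ∑ i ∈ Iᶜ, ∑ r ∈ A i ∩ Finset.univ.biUnion B, v r ≤ n * (beta * lam) := by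
    calc _ ≤ ∑ i ∈ Iᶜ, ∑ j, ∑ r ∈ B j ∩ A i, v r := Finset.sum_le_sum fun i _ => hcover i
      _ = ∑ j, ∑ i ∈ Iᶜ, ∑ r ∈ B j ∩ A i, v r := Finset.sum_comm
      _ ≤ ∑ _j : Fin n, beta * lam := Finset.sum_le_sum fun j _ => hpack j
      _ = n * (beta * lam) := by simp
  have hkey : ((Iᶜ).card : ℝ) * (gamma * lam) < n * (beta * lam) := by
    rcases (Iᶜ).eq_empty_or_nonempty with h | h
    · rw [h, Finset.card_empty, Nat.cast_zero, zero_mul]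
      positivity
    · refine lt_of_lt_of_le ?_ hupper
      rw [← nsmul_eq_mul, ← Finset.sum_const]
      exact Finset.sum_lt_sum_of_nonempty h fun i _ => hblocked i
  have hcompl : ((Iᶜ).card : ℝ) < beta / gamma * n := by
    rw [div_mul_eq_mul_div, lt_div_iff₀ hgamma]
    refine lt_of_mul_lt_mul_right ?_ hlam.le
    linarith
  linarith
end

section
/- Let λ > 0, β > 0, γ ≥ 0 be reals, let R be a finite set with nonnegative values v_r for r ∈ R, and write v[S] = Σ_{r∈S} v_r. Let 𝒜 be a nonempty finite family of pairwise disjoint subsets of R with v[a] < (2+γ)λ for every a ∈ 𝒜, and let ℬ be a finite family of pairwise disjoint subsets of R. Let ℬ' = { b ∈ ℬ : v[b ∩ ⋃𝒜] > βλ }. Then |ℬ'| < ((2+γ)/β)·|𝒜|. -/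
/-- **Lemma (few heavily-overlapping blocking edges).**
`A 1, …, A m` are the pairwise disjoint resource sets of the addable edges of a
layer (`m ≥ 1`), each of total value less than `(2+γ)·λ`, and `B 1, …, B n` are
the pairwise disjoint resource sets of the blocking edges.  Then the number of
blocking edges sharing strictly more than `β·λ` worth of resources with the
addable edges is less than `((2+γ)/β)·m`. -/
theorem heavy_blocking_lt {R : Type*} [Fintype R] [DecidableEq R]
    (v : R → ℝ) (hv : ∀ r, 0 ≤ v r)
    (lam beta gamma : ℝ) (hlam : 0 < lam) (hbeta : 0 < beta) (hgamma : 0 ≤ gamma)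
    (m n : ℕ) (hm : 1 ≤ m)
    (A : Fin m → Finset R) (B : Fin n → Finset R)
    (hAdisj : ∀ i j : Fin m, i ≠ j → Disjoint (A i) (A j))
    (hAval : ∀ i : Fin m, ∑ r ∈ A i, v r < (2 + gamma) * lam)
    (hBdisj : ∀ i j : Fin n, i ≠ j → Disjoint (B i) (B j)) :
    ((Finset.univ.filter (fun j : Fin n =>
        beta * lam < ∑ r ∈ B j ∩ Finset.univ.biUnion A, v r)).card : ℝ)
      < ((2 + gamma) / beta) * m := by
  have hU : ∑ r ∈ Finset.univ.biUnion A, v r < m * ((2 + gamma) * lam) := by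
    rw [Finset.sum_biUnion fun i _ j _ hij => hAdisj i j hij]
    calc ∑ i, ∑ r ∈ A i, v r < ∑ _i : Fin m, (2 + gamma) * lam :=
          Finset.sum_lt_sum_of_nonempty ⟨⟨0, hm⟩, Finset.mem_univ _⟩ fun i _ => hAval i
      _ = m * ((2 + gamma) * lam) := by simp
  set H := Finset.univ.filter (fun j : Fin n =>
    beta * lam < ∑ r ∈ B j ∩ Finset.univ.biUnion A, v r)
  have hB : (H.card : ℝ) * (beta * lam) ≤ ∑ r ∈ Finset.univ.biUnion A, v r :=
    calc (H.card : ℝ) * (beta * lam) = ∑ _j ∈ H, beta * lam := by simp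
      _ ≤ ∑ j ∈ H, ∑ r ∈ B j ∩ Finset.univ.biUnion A, v r :=
          Finset.sum_le_sum fun j hj => (Finset.mem_filter.mp hj).2.le
      _ = ∑ r ∈ H.biUnion fun j => B j ∩ Finset.univ.biUnion A, v r :=
          (Finset.sum_biUnion fun i _ j _ hij => (hBdisj i j hij).mono
            Finset.inter_subset_left Finset.inter_subset_left).symm
      _ ≤ ∑ r ∈ Finset.univ.biUnion A, v r :=
          Finset.sum_le_sum_of_subset_of_nonneg
            (Finset.biUnion_subset.mpr fun _ _ => Finset.inter_subset_right)
            fun r _ _ => hv r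
  rw [div_mul_eq_mul_div, lt_div_iff₀ hbeta]
  refine lt_of_mul_lt_mul_right ?_ hlam.le
  linarith
end

section
/- Let G be a bipartite graph with vertex classes P (players) and F (resources), let M be a maximum matching of G, let B_1, …, B_{ℓ−1} be pairwise disjoint sets of players not matched by M, write B_{≤i} = B_1 ∪ ⋯ ∪ B_i, and let I ⊆ P be a set of players with f_M(B_{≤ℓ−1}, I) = |I|. Then there exist pairwise disjoint sets I_1, …, I_{ℓ−1} with I_1 ∪ ⋯ ∪ I_{ℓ−1} = I and path families Γ_1, …, Γ_{ℓ−1} such that: all paths in Γ_1 ∪ ⋯ ∪ Γ_{ℓ−1} are pairwise vertex-disjoint directed paths in G_M; for every i, Γ_i consists of exactly |I_i| paths, each starting at a vertex of B_i and ending at a vertex of I_i, with every vertex of I_i an endpoint of a path of Γ_i; and for every i ∈ {1,…,ℓ−1}, writing I_{≤i} = I_1 ∪ ⋯ ∪ I_i, one has f_M(B_{≤i}, I_{≤i}) = f_M(B_{≤i}, I) = |I_{≤i}|. (This is the existence of a canonical decomposition of I together with a corresponding canonical solution.) -/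
section Framework

variable {P F : Type*} [Fintype P] [Fintype F] [DecidableEq P] [DecidableEq F]

/-- A matching of the bipartite graph with edge relation `E`: a set of
player–resource pairs that are edges, no two sharing a player or a resource. -/
def IsMatching (E : P → F → Prop) (M : Finset (P × F)) : Prop :=
  (∀ e ∈ M, E e.1 e.2) ∧
  (∀ e ∈ M, ∀ e' ∈ M, e.1 = e'.1 → e = e') ∧
  (∀ e ∈ M, ∀ e' ∈ M, e.2 = e'.2 → e = e')

/-- A maximum matching of the bipartite graph with edge relation `E`. -/
def IsMaxMatching (E : P → F → Prop) (M : Finset (P × F)) : Prop :=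
  IsMatching E M ∧ ∀ M' : Finset (P × F), IsMatching E M' → M'.card ≤ M.card

/-- The directed graph `G_M`: each edge `{p, r}` of `G` is oriented from the
resource `r` to the player `p` if `{p, r} ∈ M`, and from `p` to `r` otherwise. -/
def DirAdj (E : P → F → Prop) (M : Finset (P × F)) : P ⊕ F → P ⊕ F → Prop :=
  fun x y => match x, y with
  | Sum.inl p, Sum.inr r => E p r ∧ (p, r) ∉ M
  | Sum.inr r, Sum.inl p => (p, r) ∈ M
  | _, _ => False

/-- A (simple) directed path in the digraph with adjacency `A`, recorded as
its nonempty, duplicate-free list of vertices.  A one-vertex list is a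
trivial path. -/
def IsDirPath (A : P ⊕ F → P ⊕ F → Prop) (l : List (P ⊕ F)) : Prop :=
  l ≠ [] ∧ l.Chain' A ∧ l.Nodup

/-- The path `l` starts at a player belonging to `S`. -/
def startsIn (S : Set P) (l : List (P ⊕ F)) : Prop :=
  ∃ p ∈ S, l.head? = some (Sum.inl p)

/-- The path `l` ends at a player belonging to `T`. -/
def endsIn (T : Set P) (l : List (P ⊕ F)) : Prop :=
  ∃ q ∈ T, l.getLast? = some (Sum.inl q)

/-- A feasible solution for `G_M(S,T)`: a set of pairwise vertex-disjoint
directed paths in `G_M`, each starting at a vertex of `S` and ending at a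
vertex of `T` (single-vertex paths at vertices of `S ∩ T` are allowed). -/
def Feasible (E : P → F → Prop) (M : Finset (P × F)) (S T : Set P)
    (Ps : Finset (List (P ⊕ F))) : Prop :=
  (∀ l ∈ Ps, IsDirPath (DirAdj E M) l) ∧
  (∀ l ∈ Ps, startsIn S l) ∧
  (∀ l ∈ Ps, endsIn T l) ∧
  (∀ l ∈ Ps, ∀ l' ∈ Ps, l ≠ l' → ∀ x, x ∈ l → x ∉ l')

/-- `f_M(S,T)`: the maximum number of pairwise vertex-disjoint paths in `G_M`
from `S` to `T`. -/
noncomputable def fM (E : P → F → Prop) (M : Finset (P × F)) (S T : Set P) : ℕ :=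
  sSup {n | ∃ Ps : Finset (List (P ⊕ F)), Feasible E M S T Ps ∧ Ps.card = n}

/-- The sources of a set of paths. -/
def srcOf (Ps : Finset (List (P ⊕ F))) : Set P :=
  {p | ∃ l ∈ Ps, l.head? = some (Sum.inl p)}

/-- The sinks of a set of paths. -/
def sinkOf (Ps : Finset (List (P ⊕ F))) : Set P :=
  {p | ∃ l ∈ Ps, l.getLast? = some (Sum.inl p)}

/-- The path `l` traverses the (undirected) edge `{p, r}`. -/
def usesEdge (l : List (P ⊕ F)) (p : P) (r : F) : Prop :=
  (Sum.inl p, Sum.inr r) ∈ l.zip l.tail ∨ (Sum.inr r, Sum.inl p) ∈ l.zip l.tail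

open Classical in
/-- `M ⊕ Ps`: the symmetric difference of the matching `M` with the set of
(undirected) edges used by the paths of `Ps`. -/
noncomputable def symmDiffMatch (M : Finset (P × F)) (Ps : Finset (List (P ⊕ F))) :
    Finset (P × F) :=
  Finset.univ.filter (fun e : P × F => (∃ l ∈ Ps, usesEdge l e.1 e.2) ↔ e ∉ M)

end Framework

section Linkage

open Classical in
/-- The closed out-neighbourhood of a set of vertices of a finite digraph. -/
noncomputable def closedOutNbhd {V : Type*} [Fintype V] (A : V → V → Prop) (C : Finset V) :
    Finset V :=
  Finset.univ.filter (fun w => ∃ v ∈ C, w = v ∨ A v w)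

open Classical in
/-- The Hall-type condition characterising the sets `X` all of whose vertices start pairwise
disjoint paths into `T`. -/
def Linked {V : Type*} [Fintype V] (A : V → V → Prop) (T X : Finset V) : Prop :=
  ∀ C : Finset V, Disjoint C T → C.card ≤ (closedOutNbhd A C \ X).card

variable {V : Type*} {A : V → V → Prop} {T X S : Finset V}

theorem mem_closedOutNbhd [Fintype V] {C : Finset V} {w : V} :
    w ∈ closedOutNbhd A C ↔ ∃ v ∈ C, w = v ∨ A v w := by
  simp [closedOutNbhd]

open Classical in
theorem Linked.tight_union [Fintype V] (h : Linked A T X) {C D : Finset V} (hC : Disjoint C T)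
    (hCt : (closedOutNbhd A C \ X).card ≤ C.card)
    (hDt : (closedOutNbhd A D \ X).card ≤ D.card) :
    (closedOutNbhd A (C ∪ D) \ X).card ≤ (C ∪ D).card := by
  have h1 := h (C ∩ D) (hC.mono_left Finset.inter_subset_left)
  have h2 : (closedOutNbhd A (C ∩ D) \ X).card ≤
      ((closedOutNbhd A C \ X) ∩ (closedOutNbhd A D \ X)).card := by
    apply Finset.card_le_card
    intro w
    simp only [Finset.mem_sdiff, Finset.mem_inter, mem_closedOutNbhd]
    grind
  have h3 : closedOutNbhd A (C ∪ D) \ X =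
      (closedOutNbhd A C \ X) ∪ (closedOutNbhd A D \ X) := by
    ext w
    simp only [Finset.mem_sdiff, Finset.mem_union, mem_closedOutNbhd]
    grind
  have h4 := Finset.card_union_add_card_inter (closedOutNbhd A C \ X) (closedOutNbhd A D \ X)
  have h5 := Finset.card_union_add_card_inter C D
  rw [h3]
  omega

open Classical in
theorem Linked.exists_tight_of_not_insert [Fintype V] (h : Linked A T X) {y : V}
    (hy : ¬ Linked A T (insert y X)) :
    ∃ C, Disjoint C T ∧ (closedOutNbhd A C \ X).card ≤ C.card ∧ y ∈ closedOutNbhd A C := by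
  simp only [Linked, not_forall, not_le] at hy
  obtain ⟨C, hC, hlt⟩ := hy
  have hle := h C hC
  have he : closedOutNbhd A C \ insert y X = (closedOutNbhd A C \ X).erase y := by
    ext w
    simp only [Finset.mem_sdiff, Finset.mem_insert, Finset.mem_erase]
    tauto
  have hpred := Finset.pred_card_le_card_erase (s := closedOutNbhd A C \ X) (a := y)
  rw [he] at hlt
  refine ⟨C, hC, by omega, ?_⟩
  by_contra hmem
  rw [Finset.erase_eq_of_notMem (by simp [hmem])] at hlt
  omega

open Classical in
/-- A linked subset of `S` that cannot be extended within `S` has maximum cardinality. -/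
theorem Linked.card_le_of_maximal [Fintype V] (h : Linked A T X)
    (hmax : ∀ y ∈ S, y ∉ X → ¬ Linked A T (insert y X))
    {X' : Finset V} (hX'S : X' ⊆ S) (h' : Linked A T X') : X'.card ≤ X.card := by
  have key : ∀ Q : Finset V, Q ⊆ S \ X → ∃ C, Disjoint C T ∧
      (closedOutNbhd A C \ X).card ≤ C.card ∧ Q ⊆ closedOutNbhd A C := by
    intro Q
    induction Q using Finset.induction_on with
    | empty =>
      intro _
      exact ⟨∅, by simp, by simp [closedOutNbhd], by simp⟩
    | insert y Q hy ih =>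
      intro hQ
      obtain ⟨C, hC, hCt, hQC⟩ := ih ((Finset.subset_insert _ _).trans hQ)
      have hyS := Finset.mem_sdiff.1 (hQ (Finset.mem_insert_self y Q))
      obtain ⟨D, hD, hDt, hyD⟩ := h.exists_tight_of_not_insert (hmax y hyS.1 hyS.2)
      refine ⟨C ∪ D, Finset.disjoint_union_left.2 ⟨hC, hD⟩, h.tight_union hC hCt hDt, ?_⟩
      intro w hw
      have hwCD : w ∈ closedOutNbhd A C ∨ w ∈ closedOutNbhd A D := by
        rcases Finset.mem_insert.1 hw with rfl | hw
        · exact Or.inr hyD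
        · exact Or.inl (hQC hw)
      simp only [mem_closedOutNbhd, Finset.mem_union] at hwCD ⊢
      grind
  obtain ⟨C, hC, hCt, hSC⟩ := key (S \ X) subset_rfl
  have h1 := h' C hC
  have h2 := Finset.card_sdiff_add_card_inter (closedOutNbhd A C) X
  have h3 := Finset.card_sdiff_add_card_inter (closedOutNbhd A C) X'
  have h4 := Finset.card_sdiff_add_card_inter X (closedOutNbhd A C)
  have h5 := Finset.card_sdiff_add_card_inter X' (closedOutNbhd A C)
  have h6 : (X' \ closedOutNbhd A C).card ≤ (X \ closedOutNbhd A C).card := by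
    apply Finset.card_le_card
    intro w hw
    rw [Finset.mem_sdiff] at hw ⊢
    refine ⟨?_, hw.2⟩
    by_contra hwX
    exact hw.2 (hSC (Finset.mem_sdiff.2 ⟨hX'S hw.1, hwX⟩))
  rw [Finset.inter_comm] at h4 h5
  omega

/-- The orbits of a map that is injective off `T` and whose values off `T` avoid `X` do not
meet before reaching `T`. -/
theorem iterate_eq_iterate_of_notMem {f : V → V} (hinj : ∀ v w, v ∉ T → w ∉ T → f v = f w → v = w)
    (hX : ∀ v, v ∉ T → f v ∉ X) {x x' : V} (hx : x ∈ X) (hx' : x' ∈ X) :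
    ∀ i j : ℕ, (∀ m < i, f^[m] x ∉ T) → (∀ m < j, f^[m] x' ∉ T) →
      f^[i] x = f^[j] x' → x = x' ∧ i = j
  | 0, 0, _, _, h => ⟨h, rfl⟩
  | 0, j + 1, _, hj, h => by
    rw [Function.iterate_succ_apply'] at h
    exact absurd (h ▸ hx) (hX _ (hj j (by omega)))
  | i + 1, 0, hi, _, h => by
    rw [Function.iterate_succ_apply'] at h
    exact absurd (h ▸ hx') (hX _ (hi i (by omega)))
  | i + 1, j + 1, hi, hj, h => by
    rw [Function.iterate_succ_apply', Function.iterate_succ_apply'] at h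
    have := iterate_eq_iterate_of_notMem hinj hX hx hx' i j (fun m hm => hi m (by omega))
      (fun m hm => hj m (by omega)) (hinj _ _ (hi i (by omega)) (hj j (by omega)) h)
    exact ⟨this.1, by omega⟩

open Classical in
theorem Linked.exists_paths [Fintype V] (h : Linked A T X) :
    ∃ p : V → List V,
      (∀ x ∈ X, p x ≠ [] ∧ (p x).IsChain A ∧ (p x).Nodup ∧ (p x).head? = some x ∧
        ∃ t ∈ T, (p x).getLast? = some t) ∧
      ∀ x ∈ X, ∀ x' ∈ X, x ≠ x' → ∀ v, v ∈ p x → v ∉ p x' := by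
  obtain ⟨φ, hφinj, hφ⟩ := (Finset.all_card_le_biUnion_card_iff_exists_injective
    (fun v : {v // v ∉ T} => closedOutNbhd A {v.1} \ X)).1 (by
      intro s
      have := h (s.map (Function.Embedding.subtype _)) (by
        rw [Finset.disjoint_left]
        intro v
        simp only [Finset.mem_map, Function.Embedding.subtype_apply]
        rintro ⟨u, _, rfl⟩
        exact u.2)
      rw [Finset.card_map] at this
      refine this.trans (Finset.card_le_card ?_)
      intro w
      simp only [Finset.mem_sdiff, mem_closedOutNbhd, Finset.mem_biUnion, Finset.mem_map,
        Function.Embedding.subtype_apply, Finset.mem_singleton]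
      grind)
  let f : V → V := fun v => if hv : v ∉ T then φ ⟨v, hv⟩ else v
  have hf : ∀ v (hv : v ∉ T), f v = φ ⟨v, hv⟩ := fun v hv => dif_pos hv
  have hinj : ∀ v w, v ∉ T → w ∉ T → f v = f w → v = w := by
    intro v w hv hw hvw
    rw [hf v hv, hf w hw] at hvw
    exact congrArg Subtype.val (hφinj hvw)
  have hX : ∀ v, v ∉ T → f v ∉ X := by
    intro v hv
    rw [hf v hv]
    exact (Finset.mem_sdiff.1 (hφ ⟨v, hv⟩)).2
  have hadj : ∀ v, v ∉ T → f v = v ∨ A v (f v) := by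
    intro v hv
    have := (Finset.mem_sdiff.1 (hφ ⟨v, hv⟩)).1
    rw [← hf v hv, mem_closedOutNbhd] at this
    simpa using this
  have hreach : ∀ x ∈ X, ∃ n, f^[n] x ∈ T := by
    intro x hx
    by_contra! hn
    exact not_injective_infinite_finite (fun n : ℕ => f^[n] x) fun i j hij =>
      (iterate_eq_iterate_of_notMem hinj hX hx hx i j (fun m _ => hn m) (fun m _ => hn m) hij).2
  have hlen : ∃ n : V → ℕ, ∀ x ∈ X, f^[n x] x ∈ T ∧ ∀ m < n x, f^[m] x ∉ T := by
    refine ⟨fun x => if hx : x ∈ X then Nat.find (hreach x hx) else 0, fun x hx => ?_⟩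
    simp only [hx, dite_true]
    exact ⟨Nat.find_spec (hreach x hx), fun m hm => Nat.find_min (hreach x hx) hm⟩
  obtain ⟨n, hn⟩ := hlen
  have hunique : ∀ x ∈ X, ∀ x' ∈ X, ∀ i j : ℕ, i < n x + 1 → j < n x' + 1 →
      f^[i] x = f^[j] x' → x = x' ∧ i = j := fun x hx x' hx' i j hi hj =>
    iterate_eq_iterate_of_notMem hinj hX hx hx' i j (fun m hm => (hn x hx).2 m (by omega))
      (fun m hm => (hn x' hx').2 m (by omega))
  refine ⟨fun x => (List.range (n x + 1)).map (fun i => f^[i] x), fun x hx => ?_, ?_⟩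
  · refine ⟨by simp, ?_, ?_, by simp, f^[n x] x, (hn x hx).1, ?_⟩
    · rw [List.isChain_iff_getElem]
      intro i hi
      simp only [List.length_map, List.length_range] at hi
      simp only [List.getElem_map, List.getElem_range]
      rw [Function.iterate_succ_apply']
      refine (hadj _ ((hn x hx).2 i (by omega))).resolve_left fun heq => ?_
      rw [← Function.iterate_succ_apply' f] at heq
      have := (hunique x hx x hx (i + 1) i (by omega) (by omega) heq).2
      omega
    · refine List.Nodup.map_on ?_ List.nodup_range
      intro i hi j hj hij
      exact (hunique x hx x hx i j (List.mem_range.1 hi) (List.mem_range.1 hj) hij).2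
    · rw [List.getLast?_map, List.getLast?_range]
      simp
  · intro x hx x' hx' hne v hv hv'
    simp only [List.mem_map, List.mem_range] at hv hv'
    obtain ⟨i, hi, rfl⟩ := hv
    obtain ⟨j, hj, hij⟩ := hv'
    exact hne (hunique x hx x' hx' i j hi hj hij.symm).1

open Classical in
theorem linked_of_disjoint_paths [Fintype V] {Ps : Finset (List V)}
    (hchain : ∀ l ∈ Ps, l.IsChain A) (hnodup : ∀ l ∈ Ps, l.Nodup)
    (hend : ∀ l ∈ Ps, ∃ t ∈ T, l.getLast? = some t)
    (hdisj : ∀ l ∈ Ps, ∀ l' ∈ Ps, l ≠ l' → ∀ x, x ∈ l → x ∉ l')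
    (hX : ∀ x ∈ X, ∃ l ∈ Ps, l.head? = some x) : Linked A T X := by
  intro C hC
  have heq : ∀ l ∈ Ps, ∀ l' ∈ Ps, ∀ x, x ∈ l → x ∈ l' → l = l' := by
    intro l hl l' hl' x hx hx'
    by_contra hne
    exact hdisj l hl l' hl' hne x hx hx'
  have hidx : ∀ l ∈ Ps, ∀ l' ∈ Ps, ∀ (i j : ℕ) (x : V), l[i]? = some x → l'[j]? = some x →
      l = l' ∧ i = j := by
    intro l hl l' hl' i j x hi hj
    obtain rfl := heq l hl l' hl' x (List.mem_of_getElem? hi) (List.mem_of_getElem? hj)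
    obtain ⟨hil, hi⟩ := List.getElem?_eq_some_iff.1 hi
    obtain ⟨hjl, hj⟩ := List.getElem?_eq_some_iff.1 hj
    exact ⟨rfl, (hnodup l hl).getElem_inj_iff.1 (hi.trans hj.symm)⟩
  refine Finset.card_le_card_of_forall_subsingleton
    (fun v w => ((∀ l ∈ Ps, v ∉ l) ∧ w = v) ∨
      ∃ l ∈ Ps, ∃ i : ℕ, l[i]? = some v ∧ l[i + 1]? = some w) ?_ ?_
  · intro v hv
    by_cases hvP : ∀ l ∈ Ps, v ∉ l
    · refine ⟨v, ?_, Or.inl ⟨hvP, rfl⟩⟩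
      rw [Finset.mem_sdiff, mem_closedOutNbhd]
      refine ⟨⟨v, hv, Or.inl rfl⟩, fun hvX => ?_⟩
      obtain ⟨l, hl, hhead⟩ := hX v hvX
      exact hvP l hl (List.mem_of_mem_head? hhead)
    · push Not at hvP
      obtain ⟨l, hl, hvl⟩ := hvP
      obtain ⟨i, hi, hiv⟩ := List.getElem_of_mem hvl
      have hi1 : i + 1 < l.length := by
        by_contra hlast
        obtain ⟨t, htT, ht⟩ := hend l hl
        rw [List.getLast?_eq_getElem?, show l.length - 1 = i by omega,
          List.getElem?_eq_getElem hi, hiv] at ht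
        exact Finset.disjoint_left.1 hC hv (Option.some.inj ht ▸ htT)
      refine ⟨l[i + 1], ?_, Or.inr ⟨l, hl, i, by simp [hi, hiv], by simp [hi1]⟩⟩
      rw [Finset.mem_sdiff, mem_closedOutNbhd]
      refine ⟨⟨v, hv, Or.inr ?_⟩, fun hwX => ?_⟩
      · have := List.isChain_iff_getElem.1 (hchain l hl) i hi1
        rwa [hiv] at this
      · obtain ⟨l', hl', hhead⟩ := hX _ hwX
        rw [List.head?_eq_getElem?] at hhead
        have := (hidx l hl l' hl' (i + 1) 0 _ (by simp [hi1]) hhead).2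
        omega
  · rintro w - v ⟨-, hv⟩ v' ⟨-, hv'⟩
    rcases hv with ⟨hvP, rfl⟩ | ⟨l, hl, i, hi, hi1⟩ <;>
      rcases hv' with ⟨hvP', h⟩ | ⟨l', hl', j, hj, hj1⟩
    · exact h
    · exact absurd (List.mem_of_getElem? hj1) (hvP l' hl')
    · exact absurd (List.mem_of_getElem? hi1) (h ▸ hvP' l hl)
    · obtain ⟨rfl, hij⟩ := hidx l hl l' hl' _ _ w hi1 hj1
      obtain rfl : i = j := by omega
      exact Option.some.inj (hi.symm.trans hj)

end Linkage

/-- Greedy choice along a chain: if maximal members of `Q` inside any set are maximum, then some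
member of `Q` is maximum inside every set of the chain. -/
theorem exists_simultaneously_maximum {α : Type*} [DecidableEq α] {Q : Finset α → Prop}
    (hempty : Q ∅)
    (hmax : ∀ S X X' : Finset α, Q X → (∀ y ∈ S, y ∉ X → ¬ Q (insert y X)) → X' ⊆ S → Q X' →
      X'.card ≤ X.card)
    (S : ℕ → Finset α) (hS : Monotone S) (m : ℕ) :
    ∃ X ⊆ S m, Q X ∧ ∀ j ≤ m, ∀ X' ⊆ S j, Q X' → X'.card ≤ (X ∩ S j).card := by
  have extend : ∀ (m : ℕ) (X : Finset α), X ⊆ S m → Q X →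
      ∃ Y, X ⊆ Y ∧ Y ⊆ S m ∧ Q Y ∧ ∀ X' ⊆ S m, Q X' → X'.card ≤ (Y ∩ S m).card := by
    intro m X hXS hX
    classical
    obtain ⟨Y, hXY, hY⟩ := ((S m).powerset.filter Q).exists_le_maximal
      (Finset.mem_filter.2 ⟨Finset.mem_powerset.2 hXS, hX⟩)
    obtain ⟨hYS, hQY⟩ := Finset.mem_filter.1 hY.prop
    rw [Finset.mem_powerset] at hYS
    refine ⟨Y, hXY, hYS, hQY, fun X' hX'S hX' => ?_⟩
    rw [Finset.inter_eq_left.2 hYS]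
    refine hmax (S m) Y X' hQY (fun y hy hyY hQ => hyY ?_) hX'S hX'
    exact hY.le_of_ge (Finset.mem_filter.2 ⟨Finset.mem_powerset.2
      (Finset.insert_subset hy hYS), hQ⟩) (Finset.subset_insert y Y) (Finset.mem_insert_self y Y)
  induction m with
  | zero =>
    obtain ⟨Y, -, hYS, hY, hYmax⟩ := extend 0 ∅ (by simp) hempty
    refine ⟨Y, hYS, hY, fun j hj => ?_⟩
    obtain rfl : j = 0 := by omega
    exact hYmax
  | succ m ih =>
    obtain ⟨X, hXS, hX, hXmax⟩ := ih
    obtain ⟨Y, hXY, hYS, hY, hYmax⟩ := extend (m + 1) X (hXS.trans (hS (Nat.le_succ m))) hX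
    refine ⟨Y, hYS, hY, fun j hj X' hX'S hX' => ?_⟩
    rcases Nat.le_succ_iff.1 hj with hj | rfl
    · exact (hXmax j hj X' hX'S hX').trans
        (Finset.card_le_card (Finset.inter_subset_inter_right hXY))
    · exact hYmax X' hX'S hX'

section Feasibility

variable {P F : Type*} [Fintype P] [Fintype F] [DecidableEq P] [DecidableEq F]
  {E : P → F → Prop} {M : Finset (P × F)} {S T : Finset P}

theorem Feasible.exists_linked {Ps : Finset (List (P ⊕ F))}
    (h : Feasible E M (S : Set P) (T : Set P) Ps) :
    ∃ X ⊆ S, X.card = Ps.card ∧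
      Linked (DirAdj E M) (T.map Function.Embedding.inl) (X.map Function.Embedding.inl) := by
  classical
  obtain ⟨hpath, hstart, hend, hdisj⟩ := h
  choose s hsS hs using hstart
  refine ⟨Ps.attach.image fun l => s l.1 l.2, ?_, ?_, ?_⟩
  · exact Finset.image_subset_iff.2 fun l _ => hsS l.1 l.2
  · rw [Finset.card_image_of_injective, Finset.card_attach]
    rintro ⟨l, hl⟩ ⟨l', hl'⟩ hll
    dsimp only at hll
    by_contra hne
    refine hdisj l hl l' hl' (fun h => hne (Subtype.ext h)) (Sum.inl (s l hl))
      (List.mem_of_mem_head? (hs l hl)) ?_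
    rw [hll]
    exact List.mem_of_mem_head? (hs l' hl')
  · refine linked_of_disjoint_paths (fun l hl => (hpath l hl).2.1) (fun l hl => (hpath l hl).2.2)
      (fun l hl => ?_) hdisj (fun x hx => ?_)
    · obtain ⟨q, hq, hlast⟩ := hend l hl
      exact ⟨Sum.inl q, by simpa using hq, hlast⟩
    · simp only [Finset.mem_map, Finset.mem_image] at hx
      obtain ⟨_, ⟨l, _, rfl⟩, rfl⟩ := hx
      exact ⟨l.1, l.2, hs l.1 l.2⟩

theorem bddAbove_card_feasible :
    BddAbove {n | ∃ Ps : Finset (List (P ⊕ F)), Feasible E M (S : Set P) (T : Set P) Ps ∧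
      Ps.card = n} := by
  refine ⟨S.card, ?_⟩
  rintro _ ⟨Ps, hPs, rfl⟩
  obtain ⟨X, hXS, hX, -⟩ := hPs.exists_linked
  exact hX ▸ Finset.card_le_card hXS

theorem Feasible.card_le_fM {Ps : Finset (List (P ⊕ F))}
    (h : Feasible E M (S : Set P) (T : Set P) Ps) : Ps.card ≤ fM E M (S : Set P) (T : Set P) :=
  le_csSup bddAbove_card_feasible ⟨Ps, h, rfl⟩

theorem exists_feasible_card_eq_fM (E : P → F → Prop) (M : Finset (P × F)) (S T : Finset P) :
    ∃ Ps : Finset (List (P ⊕ F)), Feasible E M (S : Set P) (T : Set P) Ps ∧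
      Ps.card = fM E M (S : Set P) (T : Set P) :=
  Nat.sSup_mem (s := {n | ∃ Ps : Finset (List (P ⊕ F)),
    Feasible E M (S : Set P) (T : Set P) Ps ∧ Ps.card = n})
    ⟨0, ∅, by simp [Feasible], rfl⟩ bddAbove_card_feasible

end Feasibility

/-- **Existence of a canonical decomposition and a canonical solution
(Lemma on canonical decompositions).**  Let `M` be a maximum matching of the
bipartite graph `G`, let `B 0, …, B (k-1)` be pairwise disjoint sets of
players unmatched by `M` (these are `B_1, …, B_{ℓ−1}`), and let `I` be a set
of players with `f_M(B_{≤ℓ−1}, I) = |I|`.  Then `I` admits a canonical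
decomposition `I_1, …, I_{ℓ−1}` together with a corresponding canonical
solution `Γ_1 ∪ ⋯ ∪ Γ_{ℓ−1}` of pairwise vertex-disjoint directed paths of
`G_M`, where each `Γ_i` consists of `|I_i|` paths from `B_i` onto `I_i`, and
`f_M(B_{≤i}, I_{≤i}) = f_M(B_{≤i}, I) = |I_{≤i}|` for every `i`. -/
theorem canonical_decomposition_exists
    {P F : Type*} [Fintype P] [Fintype F] [DecidableEq P] [DecidableEq F]
    (E : P → F → Prop) (M : Finset (P × F)) (hM : IsMaxMatching E M)
    (k : ℕ) (B : Fin k → Finset P)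
    (hBdisj : ∀ i j : Fin k, i ≠ j → Disjoint (B i) (B j))
    (hBunmatched : ∀ i : Fin k, ∀ p ∈ B i, ∀ r, (p, r) ∉ M)
    (I : Finset P)
    (hI : fM E M ↑(Finset.univ.biUnion B) ↑I = I.card) :
    ∃ (Isub : Fin k → Finset P) (Γ : Fin k → Finset (List (P ⊕ F))),
      -- the `I_i` are pairwise disjoint and partition `I`
      (∀ i j : Fin k, i ≠ j → Disjoint (Isub i) (Isub j)) ∧
      Finset.univ.biUnion Isub = I ∧
      -- the `Γ_i` are pairwise disjoint families of directed paths of `G_M`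
      (∀ i j : Fin k, i ≠ j → Disjoint (Γ i) (Γ j)) ∧
      (∀ i : Fin k, ∀ l ∈ Γ i, IsDirPath (DirAdj E M) l) ∧
      -- all the paths are pairwise vertex-disjoint
      (∀ i j : Fin k, ∀ l ∈ Γ i, ∀ l' ∈ Γ j, l ≠ l' → ∀ x, x ∈ l → x ∉ l') ∧
      -- `Γ_i` consists of exactly `|I_i|` paths from `B_i` to `I_i`
      (∀ i : Fin k, (Γ i).card = (Isub i).card) ∧
      (∀ i : Fin k, ∀ l ∈ Γ i, startsIn ↑(B i) l ∧ endsIn ↑(Isub i) l) ∧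
      -- every vertex of `I_i` is the endpoint of a path of `Γ_i`
      (∀ i : Fin k, ∀ q ∈ Isub i, ∃ l ∈ Γ i, l.getLast? = some (Sum.inl q)) ∧
      -- canonical decomposition equalities
      (∀ i : Fin k,
        fM E M ↑((Finset.univ.filter (fun j => j ≤ i)).biUnion B)
             ↑((Finset.univ.filter (fun j => j ≤ i)).biUnion Isub)
          = fM E M ↑((Finset.univ.filter (fun j => j ≤ i)).biUnion B) ↑I ∧
        fM E M ↑((Finset.univ.filter (fun j => j ≤ i)).biUnion B) ↑I
          = ((Finset.univ.filter (fun j => j ≤ i)).biUnion Isub).card) := by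
  classical
  let A := DirAdj E M
  let Q : Finset P → Prop := fun X =>
    Linked A (I.map Function.Embedding.inl) (X.map Function.Embedding.inl)
  let S : ℕ → Finset P := fun m => (Finset.univ.filter (fun j : Fin k => j.val < m)).biUnion B
  have hSmono : Monotone S := fun a b hab => by
    refine Finset.biUnion_subset_biUnion_of_subset_left B fun j hj => ?_
    simp only [Finset.mem_filter, Finset.mem_univ, true_and] at hj ⊢
    omega
  have hSk : S k = Finset.univ.biUnion B := by simp [S]
  have hSle : ∀ i : Fin k, S (i.val + 1) =
      (Finset.univ.filter (fun j : Fin k => j ≤ i)).biUnion B := fun i => by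
    simp only [S, Nat.lt_succ_iff, Fin.le_def]
  have hempty : Q ∅ := by
    refine linked_of_disjoint_paths (Ps := ∅) ?_ ?_ ?_ ?_ ?_ <;> simp
  obtain ⟨X, hXS, hXQ, hXmax⟩ := exists_simultaneously_maximum hempty
    (fun S X X' hX hmax hX'S hX' => by
      have := Linked.card_le_of_maximal (S := S.map Function.Embedding.inl) hX
        (by
          intro y hy hyX
          obtain ⟨z, hz, rfl⟩ := Finset.mem_map.1 hy
          have hz' := hmax z hz (fun hzX => hyX (Finset.mem_map_of_mem _ hzX))
          simp only [Q, Finset.map_insert] at hz'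
          convert hz')
        (Finset.map_subset_map.2 hX'S) hX'
      simpa using this) S hSmono k
  obtain ⟨p', hp', hdisj'⟩ := Linked.exists_paths hXQ
  let p : P → List (P ⊕ F) := fun x => p' (Sum.inl x)
  have hpath : ∀ x ∈ X, IsDirPath A (p x) := fun x hx =>
    have h := hp' _ (Finset.mem_map_of_mem _ hx)
    ⟨h.1, h.2.1, h.2.2.1⟩
  have hhead : ∀ x ∈ X, (p x).head? = some (Sum.inl x) := fun x hx =>
    (hp' _ (Finset.mem_map_of_mem _ hx)).2.2.2.1
  have hlast : ∀ x ∈ X, ∃ q ∈ I, (p x).getLast? = some (Sum.inl q) := by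
    intro x hx
    obtain ⟨t, ht, hxt⟩ := (hp' _ (Finset.mem_map_of_mem _ hx)).2.2.2.2
    obtain ⟨q, hq, rfl⟩ := Finset.mem_map.1 ht
    exact ⟨q, hq, hxt⟩
  choose! e heI he using hlast
  have huniq : ∀ x ∈ X, ∀ x' ∈ X, ∀ v, v ∈ p x → v ∈ p x' → x = x' := by
    intro x hx x' hx' v hv hv'
    by_contra hne
    exact hdisj' _ (Finset.mem_map_of_mem _ hx) _ (Finset.mem_map_of_mem _ hx')
      (fun h => hne (Sum.inl_injective h)) v hv hv'
  have hpinj : ∀ x ∈ X, ∀ x' ∈ X, p x = p x' → x = x' := fun x hx x' hx' h =>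
    huniq x hx x' hx' _ (List.mem_of_mem_head? (hhead x hx))
      (h ▸ List.mem_of_mem_head? (hhead x hx))
  have heinj : ∀ x ∈ X, ∀ x' ∈ X, e x = e x' → x = x' := fun x hx x' hx' h =>
    huniq x hx x' hx' _ (List.mem_of_getLast? (he x hx))
      (h ▸ List.mem_of_getLast? (he x' hx'))
  have hfeas : ∀ Y ⊆ X, ∀ S₀ T₀ : Finset P, Y ⊆ S₀ → Y.image e ⊆ T₀ →
      Feasible E M (S₀ : Set P) (T₀ : Set P) (Y.image p) := by
    intro Y hY S₀ T₀ hS hT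
    refine ⟨?_, ?_, ?_, ?_⟩
    · exact Finset.forall_mem_image.2 fun x hx => hpath x (hY hx)
    · exact Finset.forall_mem_image.2 fun x hx => ⟨x, hS hx, hhead x (hY hx)⟩
    · exact Finset.forall_mem_image.2 fun x hx =>
        ⟨e x, hT (Finset.mem_image_of_mem e hx), he x (hY hx)⟩
    · refine Finset.forall_mem_image.2 fun x hx => Finset.forall_mem_image.2 fun x' hx' => ?_
      intro hne v hv hv'
      exact hne (congrArg p (huniq x (hY hx) x' (hY hx') v hv hv'))
  have hcardp : ∀ Y ⊆ X, (Y.image p).card = Y.card := fun Y hY =>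
    Finset.card_image_of_injOn fun x hx x' hx' => hpinj x (hY hx) x' (hY hx')
  have hcarde : ∀ Y ⊆ X, (Y.image e).card = Y.card := fun Y hY =>
    Finset.card_image_of_injOn fun x hx x' hx' => heinj x (hY hx) x' (hY hx')
  have hsub : ∀ s : Finset P, X ∩ s ⊆ X := fun s => Finset.inter_subset_left
  have himage : X.image e = I := by
    refine Finset.eq_of_subset_of_card_le (Finset.image_subset_iff.2 heI) ?_
    obtain ⟨Ps, hPs, hPsc⟩ := exists_feasible_card_eq_fM E M (Finset.univ.biUnion B) I
    obtain ⟨X', hX'S, hX', hX'Q⟩ := hPs.exists_linked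
    have := hXmax k le_rfl X' (hSk ▸ hX'S) hX'Q
    rw [Finset.inter_eq_left.2 hXS] at this
    rw [hcarde X subset_rfl, ← hI]
    omega
  have hBX : ∀ i j : Fin k, i ≠ j → Disjoint (X ∩ B i) (X ∩ B j) := fun i j hij =>
    (hBdisj i j hij).mono Finset.inter_subset_right Finset.inter_subset_right
  refine ⟨fun i => (X ∩ B i).image e, fun i => (X ∩ B i).image p, ?_, ?_, ?_, ?_, ?_, ?_, ?_,
    ?_, ?_⟩
  · intro i j hij
    refine Finset.disjoint_left.2 (Finset.forall_mem_image.2 fun x hx himg => ?_)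
    obtain ⟨x', hx', hxx'⟩ := Finset.mem_image.1 himg
    obtain rfl := heinj x' (hsub _ hx') x (hsub _ hx) hxx'
    exact Finset.disjoint_left.1 (hBX i j hij) hx hx'
  · rw [← Finset.biUnion_image, ← Finset.inter_biUnion, ← hSk, Finset.inter_eq_left.2 hXS, himage]
  · intro i j hij
    refine Finset.disjoint_left.2 (Finset.forall_mem_image.2 fun x hx himg => ?_)
    obtain ⟨x', hx', hxx'⟩ := Finset.mem_image.1 himg
    obtain rfl := hpinj x' (hsub _ hx') x (hsub _ hx) hxx'
    exact Finset.disjoint_left.1 (hBX i j hij) hx hx'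
  · exact fun i => Finset.forall_mem_image.2 fun x hx => hpath x (hsub _ hx)
  · intro i j l hl l' hl'
    exact (hfeas X subset_rfl X (X.image e) subset_rfl subset_rfl).2.2.2 l
      (Finset.image_subset_image (hsub _) hl) l' (Finset.image_subset_image (hsub _) hl')
  · intro i
    rw [hcardp _ (hsub _), hcarde _ (hsub _)]
  · intro i l hl
    have h := hfeas _ (hsub (B i)) (B i) _ Finset.inter_subset_right subset_rfl
    exact ⟨h.2.1 l hl, h.2.2.1 l hl⟩
  · exact fun i => Finset.forall_mem_image.2 fun x hx =>
      ⟨p x, Finset.mem_image_of_mem p hx, he x (hsub _ hx)⟩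
  · intro i
    rw [← Finset.biUnion_image, ← Finset.inter_biUnion, ← hSle i, hcarde _ (hsub _)]
    have upper : fM E M (S (i.val + 1) : Set P) (I : Set P) ≤ (X ∩ S (i.val + 1)).card := by
      obtain ⟨Ps, hPs, hPsc⟩ := exists_feasible_card_eq_fM E M (S (i.val + 1)) I
      obtain ⟨X', hX'S, hX', hX'Q⟩ := hPs.exists_linked
      have := hXmax (i.val + 1) i.isLt X' hX'S hX'Q
      omega
    have hTI : (X ∩ S (i.val + 1)).image e ⊆ I := himage ▸ Finset.image_subset_image (hsub _)
    have lower := (hfeas _ (hsub _) _ _ Finset.inter_subset_right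
      (subset_refl ((X ∩ S (i.val + 1)).image e))).card_le_fM
    rw [hcardp _ (hsub _)] at lower
    have mono : fM E M (S (i.val + 1) : Set P) ((X ∩ S (i.val + 1)).image e : Finset P) ≤
        fM E M (S (i.val + 1) : Set P) (I : Set P) := by
      obtain ⟨Ps, hPs, hPsc⟩ := exists_feasible_card_eq_fM E M (S (i.val + 1))
        ((X ∩ S (i.val + 1)).image e)
      rw [← hPsc]
      refine Feasible.card_le_fM ⟨hPs.1, hPs.2.1, fun l hl => ?_, hPs.2.2.2⟩
      obtain ⟨q, hq, hlq⟩ := hPs.2.2.1 l hl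
      exact ⟨q, hTI hq, hlq⟩
    exact ⟨by omega, by omega⟩
end

section
/- Let G be a bipartite graph with vertex classes P (players) and F (resources), let M be a maximum matching of G, let S be a set of players not matched by M, let T be a set of players, and let Π be a feasible solution for G_M(S,T) that is not optimal. Then there exists a directed path π in G_{M⊕Π} from a vertex of S ∖ src_Π to a vertex of T ∖ sink_Π, and a feasible solution Π' for G_M(S,T) such that |Π'| = |Π| + 1, src_{Π'} = src_Π ∪ {starting vertex of π}, sink_{Π'} = sink_Π ∪ {ending vertex of π}, and the set of vertices used by the paths of Π' is contained in the union of the vertices used by Π and by π. -/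
namespace PathAugmentation

open Relation

section Lists

variable {α : Type*}

theorem mem_of_mem_zip_tail {l : List α} {x y : α} (h : (x, y) ∈ l.zip l.tail) :
    x ∈ l ∧ y ∈ l :=
  ⟨(List.of_mem_zip h).1, List.mem_of_mem_tail (List.of_mem_zip h).2⟩

theorem mem_zip_tail_cons_cons {a b x y : α} {t : List α} :
    (x, y) ∈ (a :: b :: t).zip (a :: b :: t).tail ↔
      (x = a ∧ y = b) ∨ (x, y) ∈ (b :: t).zip (b :: t).tail := by
  simp

theorem isChain_of_zip_tail {r : α → α → Prop} {l : List α}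
    (h : ∀ x y, (x, y) ∈ l.zip l.tail → r x y) : l.IsChain r := by
  induction l with
  | nil => simp
  | cons a t ih =>
    cases t with
    | nil => simp
    | cons b t =>
      rw [List.isChain_cons_cons]
      exact ⟨h a b (mem_zip_tail_cons_cons.2 (.inl ⟨rfl, rfl⟩)),
        ih fun x y hxy => h x y (mem_zip_tail_cons_cons.2 (.inr hxy))⟩

theorem rel_of_mem_zip_tail {r : α → α → Prop} {l : List α} (h : l.IsChain r) {x y : α}
    (hxy : (x, y) ∈ l.zip l.tail) : r x y := by
  induction l with
  | nil => simp at hxy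
  | cons a t ih =>
    cases t with
    | nil => simp at hxy
    | cons b t =>
      rw [List.isChain_cons_cons] at h
      rcases mem_zip_tail_cons_cons.1 hxy with ⟨rfl, rfl⟩ | hxy
      · exact h.1
      · exact ih h.2 hxy

/-- Reachability is witnessed by a duplicate-free path whose vertices are all reachable. -/
theorem exists_nodup_chain {r : α → α → Prop} {a b : α} (h : ReflTransGen r a b) :
    ∃ l : List α, l.IsChain r ∧ l.Nodup ∧ l.head? = some a ∧ l.getLast? = some b ∧
      ∀ x ∈ l, ReflTransGen r a x := by
  induction h using ReflTransGen.head_induction_on with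
  | refl => exact ⟨[b], by simp, by simp, rfl, rfl, by simp [ReflTransGen.refl]⟩
  | @head a c hac _ ih =>
    obtain ⟨l, hc, hn, hh, hl, hr⟩ := ih
    by_cases ha : a ∈ l
    · obtain ⟨s, t, rfl⟩ := List.append_of_mem ha
      have hc' : (a :: t).IsChain r := (List.isChain_append.1 hc).2.1
      refine ⟨a :: t, hc', hn.of_append_right, rfl, by simpa using hl, fun x hx => ?_⟩
      exact .head hac (hr x (by simp only [List.mem_append]; exact .inr hx))
    · cases l with
      | nil => simp at hh
      | cons d t =>
        obtain rfl : d = c := by simpa using hh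
        refine ⟨a :: d :: t, List.isChain_cons_cons.2 ⟨hac, hc⟩, List.nodup_cons.2 ⟨ha, hn⟩, rfl,
          by simpa using hl, fun x hx => ?_⟩
        rcases List.mem_cons.1 hx with rfl | hx
        · exact .refl
        · exact .head hac (hr x hx)

/-- A list starting in `R` either steps out of `R` somewhere or ends in `R`. -/
theorem exists_exit_or_getLast_mem (R : Set α) (l : List α) {a b : α}
    (hh : l.head? = some a) (ha : a ∈ R) (hl : l.getLast? = some b) :
    (∃ x y, (x, y) ∈ l.zip l.tail ∧ x ∈ R ∧ y ∉ R) ∨ b ∈ R := by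
  induction l generalizing a with
  | nil => simp at hh
  | cons c t ih =>
    obtain rfl : c = a := by simpa using hh
    cases t with
    | nil =>
      obtain rfl : c = b := by simpa using hl
      exact .inr ha
    | cons d t =>
      by_cases hd : d ∈ R
      · rcases ih rfl hd (by simpa using hl) with ⟨x, y, hxy, h⟩ | h
        · exact .inl ⟨x, y, mem_zip_tail_cons_cons.2 (.inr hxy), h⟩
        · exact .inr h
      · exact .inl ⟨c, d, mem_zip_tail_cons_cons.2 (.inl ⟨rfl, rfl⟩), ha, hd⟩

open Classical in
/-- The vertex at which a list that never enters `R` from outside meets the boundary of `R`: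
its head if that lies outside `R`, and its last vertex before leaving `R` otherwise. -/
noncomputable def exitVertex (R : Set α) : List α → Option α
  | [] => none
  | [x] => some x
  | x :: y :: t => if x ∈ R ∧ y ∈ R then exitVertex R (y :: t) else some x

theorem exitVertex_of_head_notMem {R : Set α} {l : List α} {a : α}
    (hh : l.head? = some a) (ha : a ∉ R) : exitVertex R l = some a := by
  match l, hh with
  | [x], hh => simpa [exitVertex] using hh
  | x :: y :: t, hh =>
    obtain rfl : x = a := by simpa using hh
    simp [exitVertex, ha]

theorem head_mem_of_mem {R : Set α} {a : α} {l : List α}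
    (h : (a :: l).IsChain fun x y => y ∈ R → x ∈ R) {x : α} (hx : x ∈ a :: l) (hxR : x ∈ R) :
    a ∈ R := by
  induction l generalizing a with
  | nil =>
    obtain rfl : x = a := by simpa using hx
    exact hxR
  | cons b t ih =>
    rw [List.isChain_cons_cons] at h
    rcases List.mem_cons.1 hx with rfl | hx
    · exact hxR
    · exact h.1 (ih h.2 hx)

theorem exitVertex_of_exit {R : Set α} {l : List α} {x y : α}
    (h : l.IsChain fun x y => y ∈ R → x ∈ R) (hxy : (x, y) ∈ l.zip l.tail)
    (hx : x ∈ R) (hy : y ∉ R) : exitVertex R l = some x := by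
  induction l with
  | nil => simp at hxy
  | cons a t ih =>
    cases t with
    | nil => simp at hxy
    | cons b t =>
      rcases mem_zip_tail_cons_cons.1 hxy with ⟨rfl, rfl⟩ | hxy
      · simp [exitVertex, hy]
      · have hb : b ∈ R :=
          head_mem_of_mem (List.isChain_cons_cons.1 h).2 (mem_of_mem_zip_tail hxy).1 hx
        simp only [exitVertex, (List.isChain_cons_cons.1 h).1 hb, hb, and_self, if_true]
        exact ih (List.isChain_cons_cons.1 h).2 hxy

theorem exitVertex_of_getLast_mem {R : Set α} {l : List α} {b : α}
    (h : l.IsChain fun x y => y ∈ R → x ∈ R) (hl : l.getLast? = some b) (hb : b ∈ R) :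
    exitVertex R l = some b := by
  induction l with
  | nil => simp at hl
  | cons a t ih =>
    cases t with
    | nil => simpa [exitVertex] using hl
    | cons c t =>
      have hl' : (c :: t).getLast? = some b := by simpa using hl
      have hc : c ∈ R :=
        head_mem_of_mem (List.isChain_cons_cons.1 h).2 (List.mem_of_getLast? hl') hb
      simp only [exitVertex, (List.isChain_cons_cons.1 h).1 hc, hc, and_self, if_true]
      exact ih (List.isChain_cons_cons.1 h).2 hl'

end Lists

section Linking

variable {α : Type*}

/-- Following a partial injection on a finite set from a point without predecessor, one
eventually gets stuck. -/
theorem exists_terminal [Finite α] {r : α → α → Prop}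
    (hin : ∀ x y z, r x z → r y z → x = y) {a : α} (ha : ∀ x, ¬ r x a) :
    ∃ b, ReflTransGen r a b ∧ ∀ y, ¬ r b y := by
  by_contra! hcon
  choose f hf using fun x : {x // ReflTransGen r a x} => hcon x.1 x.2
  let g : {x // ReflTransGen r a x} → {x // ReflTransGen r a x} :=
    fun x => ⟨f x, x.2.tail (hf x)⟩
  have hg : Function.Injective g := fun x y hxy => by
    have hfx : f x = f y := congrArg Subtype.val hxy
    exact Subtype.ext (hin _ _ _ (hf x) (hfx ▸ hf y))
  obtain ⟨x, hx⟩ := Finite.injective_iff_surjective.1 hg ⟨a, .refl⟩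
  exact ha x (by have := hf x; rwa [show f x = a from congrArg Subtype.val hx] at this)

theorem eq_of_reach {r : α → α → Prop} (hin : ∀ x y z, r x z → r y z → x = y) {a a' x : α}
    (ha : ∀ x, ¬ r x a) (ha' : ∀ x, ¬ r x a') (h : ReflTransGen r a x)
    (h' : ReflTransGen r a' x) : a = a' := by
  induction h with
  | refl =>
    rcases h'.cases_tail with h | ⟨c, _, hc⟩
    · exact h
    · exact absurd hc (ha c)
  | tail h1 h2 ih =>
    rcases h'.cases_tail with h | ⟨c, hc', hc⟩
    · exact absurd (h ▸ h2) (ha' _)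
    · exact ih (hin _ _ _ hc h2 ▸ hc')

end Linking

section Matchings

variable {P F : Type*} {E : P → F → Prop} {M N : Finset (P × F)} {A B S T : Set P}

theorem usesEdge_mem {l : List (P ⊕ F)} {p : P} {r : F} (h : usesEdge l p r) :
    Sum.inl p ∈ l ∧ Sum.inr r ∈ l := by
  rcases h with h | h
  · exact mem_of_mem_zip_tail h
  · exact (mem_of_mem_zip_tail h).symm

theorem isChain_dirAdj_congr {l : List (P ⊕ F)}
    (h : ∀ p r, usesEdge l p r → ((p, r) ∈ M ↔ (p, r) ∈ N))
    (hl : l.IsChain (DirAdj E M)) : l.IsChain (DirAdj E N) := by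
  refine isChain_of_zip_tail fun x y hxy => ?_
  have hxy' := rel_of_mem_zip_tail hl hxy
  match x, y, hxy, hxy' with
  | .inl p, .inr r, hxy, h' => exact ⟨h'.1, fun hN => h'.2 ((h p r (.inl hxy)).2 hN)⟩
  | .inr r, .inl p, hxy, h' => exact (h p r (.inr hxy)).1 h'

/-- Flipping a directed path from an unmatched player `a` to a player `b` yields a matching of
the same resources in which `a` is matched instead of `b`. -/
theorem exists_flip {N : Finset (P × F)} (hN : IsMatching E N) (l : List (P ⊕ F)) {a b : P}
    (hc : l.IsChain (DirAdj E N)) (hn : l.Nodup) (hh : l.head? = some (.inl a))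
    (hl : l.getLast? = some (.inl b)) (ha : ∀ r, (a, r) ∉ N) :
    ∃ N' : Finset (P × F), IsMatching E N' ∧
      (∀ p r, (p, r) ∈ N' ↔ (usesEdge l p r ↔ (p, r) ∉ N)) ∧
      (∀ r, (∃ p, (p, r) ∈ N') → ∃ p, (p, r) ∈ N) ∧
      (∀ r, (b, r) ∉ N') ∧
      ∀ p, ((∃ r, (p, r) ∈ N') ∨ p = b) ↔ ((∃ r, (p, r) ∈ N) ∨ p = a) := by
  match l, hc, hn, hh, hl with
  | [x], _, _, hh, hl =>
    obtain rfl : x = .inl a := by simpa using hh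
    obtain rfl : a = b := by simpa using hl
    exact ⟨N, hN, by simp [usesEdge], fun _ h => h, ha, fun _ => Iff.rfl⟩
  | [x, y], hc, _, hh, hl =>
    obtain rfl : x = .inl a := by simpa using hh
    obtain rfl : y = .inl b := by simpa using hl
    exact absurd (List.isChain_cons_cons.1 hc).1 (by simp [DirAdj])
  | x :: y :: z :: t, hc, hn, hh, hl =>
    classical
    obtain rfl : x = .inl a := by simpa using hh
    rw [List.isChain_cons_cons, List.isChain_cons_cons] at hc
    obtain ⟨hxy, hyz, hc⟩ := hc
    match y, z, hxy, hyz with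
    | .inr r, .inl p, hxy, hyz =>
    have har : E a r := hxy.1
    have hpr : (p, r) ∈ N := hyz
    have hat : Sum.inl a ∉ (Sum.inl p :: t : List (P ⊕ F)) := fun h =>
      (List.nodup_cons.1 hn).1 (List.mem_cons_of_mem _ h)
    have hrt : Sum.inr r ∉ (Sum.inl p :: t : List (P ⊕ F)) :=
      (List.nodup_cons.1 (List.nodup_cons.1 hn).2).1
    have hnt := (List.nodup_cons.1 (List.nodup_cons.1 hn).2).2
    have hmem : ∀ q s, (q, s) ∈ insert (a, r) (N.erase (p, r)) ↔
        (q = a ∧ s = r) ∨ (¬(q = p ∧ s = r) ∧ (q, s) ∈ N) := by simp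
    set N₁ := insert (a, r) (N.erase (p, r))
    clear_value N₁
    obtain ⟨hE, hP, hF⟩ := hN
    have hP' : ∀ q s s', (q, s) ∈ N → (q, s') ∈ N → s = s' := fun q s s' h h' =>
      congrArg Prod.snd (hP _ h _ h' rfl)
    have hF' : ∀ q q' s, (q, s) ∈ N → (q', s) ∈ N → q = q' := fun q q' s h h' =>
      congrArg Prod.fst (hF _ h _ h' rfl)
    have hN₁m : IsMatching E N₁ := by
      refine ⟨?_, ?_, ?_⟩
      · rintro ⟨q, s⟩ h
        rcases (hmem q s).1 h with ⟨rfl, rfl⟩ | ⟨_, h⟩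
        · exact har
        · exact hE _ h
      · rintro ⟨q, s⟩ h ⟨q', s'⟩ h' (rfl : q = q')
        rw [hmem] at h h'
        grind
      · rintro ⟨q, s⟩ h ⟨q', s'⟩ h' (rfl : s = s')
        rw [hmem] at h h'
        grind
    have hp₁ : ∀ s, (p, s) ∉ N₁ := by
      intro s
      rw [hmem]
      grind
    have hdis : ∀ q s, usesEdge (Sum.inl p :: t) q s → q ≠ a ∧ s ≠ r := by
      intro q s h
      have := usesEdge_mem h
      exact ⟨fun h => hat (h ▸ this.1), fun h => hrt (h ▸ this.2)⟩
    have hc₁ : (Sum.inl p :: t).IsChain (DirAdj E N₁) := by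
      refine isChain_dirAdj_congr (fun q s h => ?_) hc
      have := hdis q s h
      rw [hmem]
      tauto
    obtain ⟨N', h1, h2, h3, h4, h5⟩ :=
      exists_flip hN₁m (Sum.inl p :: t) hc₁ hnt rfl (by simpa using hl) hp₁
    refine ⟨N', h1, fun q s => ?_, fun s hs => ?_, h4, fun q => ?_⟩
    · have hu : usesEdge (Sum.inl a :: Sum.inr r :: Sum.inl p :: t) q s ↔
          (q = a ∧ s = r) ∨ (q = p ∧ s = r) ∨ usesEdge (Sum.inl p :: t) q s := by
        simp only [usesEdge, mem_zip_tail_cons_cons]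
        simp
        tauto
      have := hdis q s
      have := ha s
      rw [h2, hu, hmem]
      grind
    · obtain ⟨q, hq⟩ := h3 s hs
      rw [hmem] at hq
      grind
    · rw [h5]
      simp only [hmem]
      grind
termination_by l.length

/-- `N` arises from `M` by matching the players of `A` and unmatching those of `B`, without
using new resources. -/
structure Balanced (E : P → F → Prop) (M N : Finset (P × F)) (A B : Set P) : Prop where
  matching : IsMatching E N
  resource : ∀ p r, (p, r) ∈ N → ∃ q, (q, r) ∈ M
  source : ∀ p ∈ A, ∀ r, (p, r) ∉ M
  sink : ∀ p ∈ B, ∀ r, (p, r) ∉ N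
  player : ∀ p, ((∃ r, (p, r) ∈ N) ∨ p ∈ B) ↔ ((∃ r, (p, r) ∈ M) ∨ p ∈ A)

theorem Balanced.refl (hM : IsMatching E M) : Balanced E M M ∅ ∅ :=
  ⟨hM, fun p _ h => ⟨p, h⟩, by simp, by simp, by simp⟩

theorem Balanced.flip (h : Balanced E M N A B) {l : List (P ⊕ F)} {a b : P}
    (hc : l.IsChain (DirAdj E N)) (hn : l.Nodup) (hh : l.head? = some (.inl a))
    (hl : l.getLast? = some (.inl b)) (haM : ∀ r, (a, r) ∉ M) (haA : a ∉ A)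
    {N' : Finset (P × F)} (hN' : ∀ p r, (p, r) ∈ N' ↔ (usesEdge l p r ↔ (p, r) ∉ N)) :
    Balanced E M N' (insert a A) (insert b B) := by
  have hpl := h.player
  have haN : (∀ r, (a, r) ∉ N) ∧ a ∉ B := by
    have := hpl a
    grind
  obtain ⟨K, h1, h2, h3, h4, h5⟩ := exists_flip h.matching l hc hn hh hl haN.1
  obtain rfl : K = N' := by
    ext ⟨p, r⟩
    rw [h2, hN']
  refine ⟨h1, fun p r hp => ?_, ?_, ?_, fun p => ?_⟩
  · obtain ⟨q, hq⟩ := h3 r ⟨p, hp⟩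
    exact h.resource q r hq
  · rintro p (rfl | hp)
    · exact haM
    · exact h.source p hp
  · rintro p (rfl | hp) r hr
    · exact h4 r hr
    · rcases (h5 p).1 (.inl ⟨r, hr⟩) with ⟨s, hs⟩ | rfl
      · exact h.sink p hp s hs
      · exact haN.2 hp
  · rw [Set.mem_insert_iff, Set.mem_insert_iff, ← or_assoc, h5 p, or_right_comm, hpl p]
    tauto

/-- The edges in which the balanced matchings `M` and `N` differ decompose into disjoint
paths of `G_M` from `A` to `B`. -/
theorem Balanced.exists_feasible [Finite P] [Finite F] (hM : IsMatching E M)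
    (h : Balanced E M N A B) (hA : A ⊆ S) (hB : B ⊆ T) :
    ∃ Ps : Finset (List (P ⊕ F)), Feasible E M S T Ps ∧ srcOf Ps = A ∧ sinkOf Ps ⊆ B ∧
      ∀ m ∈ Ps, ∀ x ∈ m, (∃ a ∈ A, x = .inl a) ∨
        ∃ p r, ((p, r) ∈ M ↔ (p, r) ∉ N) ∧ (x = .inl p ∨ x = .inr r) := by
  classical
  let D : P ⊕ F → P ⊕ F → Prop := fun x y => DirAdj E M x y ∧ DirAdj E N y x
  have hin : ∀ x y z, D x z → D y z → x = y := by
    intro x y z hx hy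
    match x, y, z, hx, hy with
    | .inl p, .inl q, .inr r, hx, hy =>
      exact congrArg (Sum.inl ∘ Prod.fst) (h.matching.2.2 _ hx.2 _ hy.2 rfl)
    | .inr r, .inr s, .inl p, hx, hy =>
      exact congrArg (Sum.inr ∘ Prod.snd) (hM.2.1 _ hx.1 _ hy.1 rfl)
  have hstart : ∀ a ∈ A, ∀ x, ¬ D x (.inl a) := by
    rintro a ha (p | r) ⟨h1, h2⟩
    · exact h1
    · exact h.source a ha r h1
  have hplayer : ∀ p : P, ((∃ r, (p, r) ∈ M) ∨ p ∈ A) → (∀ y, ¬ D (.inl p) y) →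
      (∀ r, (p, r) ∈ M → (p, r) ∉ N) → p ∈ B := by
    intro p hp hD hMN
    rcases (h.player p).2 hp with ⟨r, hr⟩ | hB
    · exact absurd ⟨⟨h.matching.1 _ hr, fun hm => hMN r hm hr⟩, hr⟩ (hD (.inr r))
    · exact hB
  have hend : ∀ a ∈ A, ∀ x, ReflTransGen D (.inl a) x → (∀ y, ¬ D x y) →
      ∃ b ∈ B, x = .inl b := by
    intro a ha x hx hD
    rcases hx.cases_tail with rfl | ⟨y, _, hyx⟩
    · exact ⟨a, hplayer a (.inr ha) hD fun r hr => absurd hr (h.source a ha r), rfl⟩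
    · match y, x, hyx with
      | .inl p, .inr r, hyx =>
        obtain ⟨q, hq⟩ := h.resource p r hyx.2
        refine absurd ⟨hq, hM.1 _ hq, fun hqN => ?_⟩ (hD (.inl q))
        obtain rfl : p = q := congrArg Prod.fst (h.matching.2.2 _ hyx.2 _ hqN rfl)
        exact hyx.1.2 hq
      | .inr r, .inl p, hyx =>
        refine ⟨p, hplayer p (.inl ⟨r, hyx.1⟩) hD fun s hs => ?_, rfl⟩
        obtain rfl : r = s := congrArg Prod.snd (hM.2.1 _ hyx.1 _ hs rfl)
        exact hyx.2.2
  have hpath : ∀ a ∈ A, ∃ l : List (P ⊕ F), l.IsChain D ∧ l.Nodup ∧ l.head? = some (.inl a) ∧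
      (∃ b ∈ B, l.getLast? = some (.inl b)) ∧ ∀ x ∈ l, ReflTransGen D (.inl a) x := by
    intro a ha
    obtain ⟨x, hx, hD⟩ := exists_terminal hin (hstart a ha)
    obtain ⟨b, hb, rfl⟩ := hend a ha x hx hD
    obtain ⟨l, h1, h2, h3, h4, h5⟩ := exists_nodup_chain hx
    exact ⟨l, h1, h2, h3, ⟨b, hb, h4⟩, h5⟩
  choose! f hc hn hh hl hr using hpath
  have hAf : A.Finite := A.toFinite
  refine ⟨hAf.toFinset.image f, ⟨?_, ?_, ?_, ?_⟩, ?_, ?_, ?_⟩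
  · intro l hl'
    obtain ⟨a, ha, rfl⟩ := Finset.mem_image.1 hl'
    rw [Set.Finite.mem_toFinset] at ha
    refine ⟨fun h0 => ?_, (hc a ha).imp fun _ _ hD => hD.1, hn a ha⟩
    have := hh a ha
    simp [h0] at this
  · intro l hl'
    obtain ⟨a, ha, rfl⟩ := Finset.mem_image.1 hl'
    rw [Set.Finite.mem_toFinset] at ha
    exact ⟨a, hA ha, hh a ha⟩
  · intro l hl'
    obtain ⟨a, ha, rfl⟩ := Finset.mem_image.1 hl'
    rw [Set.Finite.mem_toFinset] at ha
    obtain ⟨b, hb, hlb⟩ := hl a ha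
    exact ⟨b, hB hb, hlb⟩
  · intro l h1 l' h2 hne x hx hx'
    obtain ⟨a, ha, rfl⟩ := Finset.mem_image.1 h1
    obtain ⟨a', ha', rfl⟩ := Finset.mem_image.1 h2
    rw [Set.Finite.mem_toFinset] at ha ha'
    refine hne (congrArg f (Sum.inl_injective (β := F) ?_))
    exact eq_of_reach hin (hstart a ha) (hstart a' ha') (hr a ha x hx) (hr a' ha' x hx')
  · ext p
    constructor
    · rintro ⟨l, hl', hp⟩
      obtain ⟨a, ha, rfl⟩ := Finset.mem_image.1 hl'
      rw [Set.Finite.mem_toFinset] at ha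
      obtain rfl : a = p := by simpa [hh a ha] using hp
      exact ha
    · intro hp
      exact ⟨f p, Finset.mem_image_of_mem f (hAf.mem_toFinset.2 hp), hh p hp⟩
  · rintro p ⟨l, hl', hp⟩
    obtain ⟨a, ha, rfl⟩ := Finset.mem_image.1 hl'
    rw [Set.Finite.mem_toFinset] at ha
    obtain ⟨b, hb, hlb⟩ := hl a ha
    obtain rfl : b = p := by simpa [hlb] using hp
    exact hb
  · intro l hl' x hx
    obtain ⟨a, ha, rfl⟩ := Finset.mem_image.1 hl'
    rw [Set.Finite.mem_toFinset] at ha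
    rcases (hr a ha x hx).cases_tail with rfl | ⟨y, _, hyx⟩
    · exact .inl ⟨a, ha, rfl⟩
    · right
      match y, x, hyx with
      | .inl p, .inr r, hyx =>
        exact ⟨p, r, iff_of_false hyx.1.2 (not_not.2 hyx.2), .inr rfl⟩
      | .inr r, .inl p, hyx =>
        exact ⟨p, r, iff_of_true hyx.1 hyx.2.2, .inl rfl⟩

theorem ncard_srcOf {Ps : Finset (List (P ⊕ F))} (h : Feasible E M S T Ps) :
    (srcOf Ps).ncard = Ps.card := by
  rw [← Set.ncard_coe_finset]
  choose f hfS hf using h.2.1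
  refine (Set.ncard_congr (s := (Ps : Set (List (P ⊕ F)))) (t := srcOf Ps) f
    (fun l hl => ⟨l, hl, hf l hl⟩) ?_ ?_).symm
  · intro l l' hl hl' heq
    by_contra hne
    exact h.2.2.2 l hl l' hl' hne _ (List.mem_of_head? (hf l hl))
      (heq ▸ List.mem_of_head? (hf l' hl'))
  · rintro p ⟨l, hl, hp⟩
    exact ⟨l, hl, by simpa [hf l hl] using hp⟩

theorem ncard_sinkOf {Ps : Finset (List (P ⊕ F))} (h : Feasible E M S T Ps) :
    (sinkOf Ps).ncard = Ps.card := by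
  rw [← Set.ncard_coe_finset]
  choose f hfT hf using h.2.2.1
  refine (Set.ncard_congr (s := (Ps : Set (List (P ⊕ F)))) (t := sinkOf Ps) f
    (fun l hl => ⟨l, hl, hf l hl⟩) ?_ ?_).symm
  · intro l l' hl hl' heq
    by_contra hne
    exact h.2.2.2 l hl l' hl' hne _ (List.mem_of_getLast? (hf l hl))
      (heq ▸ List.mem_of_getLast? (hf l' hl'))
  · rintro p ⟨l, hl, hp⟩
    exact ⟨l, hl, by simpa [hf l hl] using hp⟩

end Matchings

section Packings

variable {P F : Type*} [Fintype P] [Fintype F] [DecidableEq P] [DecidableEq F]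
  {E : P → F → Prop} {M : Finset (P × F)} {S T : Set P} {Ps : Finset (List (P ⊕ F))}

theorem mem_symmDiffMatch {p : P} {r : F} :
    (p, r) ∈ symmDiffMatch M Ps ↔ ((∃ l ∈ Ps, usesEdge l p r) ↔ (p, r) ∉ M) := by
  simp [symmDiffMatch]

theorem balanced_of_feasible (hM : IsMatching E M) (hS : ∀ p ∈ S, ∀ r, (p, r) ∉ M)
    (h : Feasible E M S T Ps) :
    Balanced E M (symmDiffMatch M Ps) (srcOf Ps) (sinkOf Ps) := by
  classical
  induction Ps using Finset.induction_on with
  | empty =>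
    have h0 : symmDiffMatch M (∅ : Finset (List (P ⊕ F))) = M := by
      ext ⟨p, r⟩
      simp [mem_symmDiffMatch]
    have h1 : srcOf (∅ : Finset (List (P ⊕ F))) = ∅ := by simp [srcOf]
    have h2 : sinkOf (∅ : Finset (List (P ⊕ F))) = ∅ := by simp [sinkOf]
    rw [h0, h1, h2]
    exact Balanced.refl hM
  | insert l Qs hl ih =>
    have hsub : ∀ m ∈ Qs, m ∈ insert l Qs := fun m => Finset.mem_insert_of_mem
    have hlm : l ∈ insert l Qs := Finset.mem_insert_self l Qs
    have hb := ih ⟨fun m hm => h.1 m (hsub m hm), fun m hm => h.2.1 m (hsub m hm),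
      fun m hm => h.2.2.1 m (hsub m hm),
      fun m hm m' hm' => h.2.2.2 m (hsub m hm) m' (hsub m' hm')⟩
    have hdis : ∀ m ∈ Qs, ∀ x ∈ l, x ∉ m := fun m hm x hx =>
      h.2.2.2 l hlm m (hsub m hm) (fun h => hl (h ▸ hm)) x hx
    have hnot : ∀ p r, usesEdge l p r → ¬ ∃ m ∈ Qs, usesEdge m p r :=
      fun p r hu ⟨m, hm, hu'⟩ => hdis m hm _ (usesEdge_mem hu).1 (usesEdge_mem hu').1
    obtain ⟨a, ha, hha⟩ := h.2.1 l hlm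
    obtain ⟨b, -, hlb⟩ := h.2.2.1 l hlm
    have hsrc : srcOf (insert l Qs) = insert a (srcOf Qs) := by
      ext p
      simp [srcOf, hha, eq_comm]
    have hsink : sinkOf (insert l Qs) = insert b (sinkOf Qs) := by
      ext p
      simp [sinkOf, hlb, eq_comm]
    rw [hsrc, hsink]
    refine hb.flip (l := l) ?_ (h.1 l hlm).2.2 hha hlb (hS a ha) ?_ fun p r => ?_
    · refine isChain_dirAdj_congr (fun p r hu => ?_) (h.1 l hlm).2.1
      have := hnot p r hu
      rw [mem_symmDiffMatch]
      grind
    · rintro ⟨m, hm, hma⟩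
      exact hdis m hm _ (List.mem_of_head? hha) (List.mem_of_head? hma)
    · have := hnot p r
      simp only [mem_symmDiffMatch, Finset.mem_insert, exists_eq_or_imp]
      grind

theorem dirAdj_symmDiffMatch_of_mem (hM : IsMatching E M) {l : List (P ⊕ F)} (hl : l ∈ Ps)
    {x y : P ⊕ F} (hxy : (x, y) ∈ l.zip l.tail) (h : DirAdj E M x y) :
    DirAdj E (symmDiffMatch M Ps) y x := by
  match x, y, hxy, h with
  | .inl p, .inr r, hxy, h =>
    exact mem_symmDiffMatch.2 (iff_of_true ⟨l, hl, .inl hxy⟩ h.2)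
  | .inr r, .inl p, hxy, h =>
    exact ⟨hM.1 _ h, fun hm => (mem_symmDiffMatch.1 hm).1 ⟨l, hl, .inr hxy⟩ h⟩

theorem dirAdj_symmDiffMatch_of_notMem (hPs : ∀ l ∈ Ps, l.IsChain (DirAdj E M)) {x y : P ⊕ F}
    (hxy : ∀ l ∈ Ps, (x, y) ∉ l.zip l.tail) (h : DirAdj E M x y) :
    DirAdj E (symmDiffMatch M Ps) x y := by
  match x, y, hxy, h with
  | .inl p, .inr r, hxy, h =>
    refine ⟨h.1, fun hm => ?_⟩
    obtain ⟨l, hl, hu | hu⟩ := (mem_symmDiffMatch.1 hm).2 h.2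
    · exact hxy l hl hu
    · exact h.2 (rel_of_mem_zip_tail (hPs l hl) hu)
  | .inr r, .inl p, hxy, h =>
    refine mem_symmDiffMatch.2 (iff_of_false ?_ (not_not.2 h))
    rintro ⟨l, hl, hu | hu⟩
    · exact (rel_of_mem_zip_tail (hPs l hl) hu).2 h
    · exact hxy l hl hu

/-- A set of vertices closed under the residual graph, containing the unused sources and no
unused sink, bounds the size of every feasible solution by that of `Ps`. -/
theorem card_le_of_closed (hM : IsMatching E M) (hPs : Feasible E M S T Ps) (R : Set (P ⊕ F))
    (hR : ∀ x y, x ∈ R → DirAdj E (symmDiffMatch M Ps) x y → y ∈ R)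
    (hsrc : ∀ p ∈ S \ srcOf Ps, Sum.inl p ∈ R) (hsink : ∀ q ∈ T \ sinkOf Ps, Sum.inl q ∉ R)
    {Qs : Finset (List (P ⊕ F))} (hQs : Feasible E M S T Qs) : Qs.card ≤ Ps.card := by
  have hchain : ∀ l ∈ Ps, l.IsChain fun x y => y ∈ R → x ∈ R := fun l hl =>
    isChain_of_zip_tail fun x y hxy hy =>
      hR y x hy (dirAdj_symmDiffMatch_of_mem hM hl hxy (rel_of_mem_zip_tail (hPs.1 l hl).2.1 hxy))
  have hmeet : ∀ m ∈ Qs, ∃ l ∈ Ps, exitVertex R l ∈ m.map some := by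
    have hmem : ∀ m : List (P ⊕ F), ∀ x ∈ m, ∀ l, exitVertex R l = some x →
        exitVertex R l ∈ m.map some := fun m x hx l h => h ▸ List.mem_map_of_mem hx
    intro m hm
    obtain ⟨p, hpS, hp⟩ := hQs.2.1 m hm
    obtain ⟨q, hqT, hq⟩ := hQs.2.2.1 m hm
    by_cases hpR : Sum.inl p ∈ R
    · rcases exists_exit_or_getLast_mem R m hp hpR hq with ⟨x, y, hxy, hx, hy⟩ | hqR
      · have hex : ∃ l ∈ Ps, (x, y) ∈ l.zip l.tail := by
          by_contra! hno
          exact hy (hR x y hx (dirAdj_symmDiffMatch_of_notMem (fun l hl => (hPs.1 l hl).2.1) hno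
            (rel_of_mem_zip_tail (hQs.1 m hm).2.1 hxy)))
        obtain ⟨l, hl, hxl⟩ := hex
        exact ⟨l, hl, hmem m x (mem_of_mem_zip_tail hxy).1 l
          (exitVertex_of_exit (hchain l hl) hxl hx hy)⟩
      · have hqs : q ∈ sinkOf Ps := by
          by_contra hno
          exact hsink q ⟨hqT, hno⟩ hqR
        obtain ⟨l, hl, hql⟩ := hqs
        exact ⟨l, hl, hmem m _ (List.mem_of_getLast? hq) l
          (exitVertex_of_getLast_mem (hchain l hl) hql hqR)⟩
    · have hps : p ∈ srcOf Ps := by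
        by_contra hno
        exact hpR (hsrc p ⟨hpS, hno⟩)
      obtain ⟨l, hl, hpl⟩ := hps
      exact ⟨l, hl, hmem m _ (List.mem_of_head? hp) l (exitVertex_of_head_notMem hpl hpR)⟩
  choose! f hf hx using hmeet
  refine Finset.card_le_card_of_injOn f hf fun m hm m' hm' heq => ?_
  by_contra hne
  obtain ⟨x, hxm, hxf⟩ := List.mem_map.1 (hx m hm)
  obtain ⟨y, hym, hyf⟩ := List.mem_map.1 (hx m' hm')
  obtain rfl : x = y := Option.some_injective _ (by rw [hxf, hyf, heq])
  exact hQs.2.2.2 m hm m' hm' hne x hxm hym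

/-- A non-optimal feasible solution admits an augmenting path in the residual graph. -/
theorem exists_augmenting_path (hM : IsMatching E M) (hPs : Feasible E M S T Ps)
    (hnotopt : Ps.card < fM E M S T) :
    ∃ (l : List (P ⊕ F)) (a b : P), l.IsChain (DirAdj E (symmDiffMatch M Ps)) ∧ l.Nodup ∧
      l.head? = some (.inl a) ∧ l.getLast? = some (.inl b) ∧
      a ∈ S \ srcOf Ps ∧ b ∈ T \ sinkOf Ps := by
  obtain ⟨_, ⟨Qs, hQs, rfl⟩, hlt⟩ := exists_lt_of_lt_csSup (s := {n | ∃ Qs, Feasible E M S T Qs ∧ Qs.card = n})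
    ⟨_, Ps, hPs, rfl⟩ hnotopt
  by_contra! hno
  refine hlt.not_ge (card_le_of_closed hM hPs
    {x | ∃ a ∈ S \ srcOf Ps, ReflTransGen (DirAdj E (symmDiffMatch M Ps)) (.inl a) x}
    (fun x y ⟨a, ha, hx⟩ hxy => ⟨a, ha, hx.tail hxy⟩) (fun p hp => ⟨p, hp, .refl⟩) ?_ hQs)
  rintro b hb ⟨a, ha, hab⟩
  obtain ⟨l, h1, h2, h3, h4, -⟩ := exists_nodup_chain hab
  exact hno l a b h1 h2 h3 h4 ha hb

end Packings

end PathAugmentation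

/-- **Augmentation of a non-optimal path packing (Corollary).**  Let `M` be a
maximum matching, `S` a set of players unmatched by `M`, `T` a set of players,
and `Ps` a non-optimal feasible solution for `G_M(S,T)`.  Then there is a
directed path `l` in `G_{M ⊕ Ps}` from `S ∖ src_Ps` to `T ∖ sink_Ps`, and a
feasible solution `Ps'` for `G_M(S,T)` with `|Ps'| = |Ps| + 1`,
`src_{Ps'} = src_Ps ∪ {start of l}`, `sink_{Ps'} = sink_Ps ∪ {end of l}`,
whose vertices are among those used by `Ps` and by `l`. -/
theorem augment_nonoptimal
    {P F : Type*} [Fintype P] [Fintype F] [DecidableEq P] [DecidableEq F]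
    (E : P → F → Prop) (M : Finset (P × F)) (hM : IsMaxMatching E M)
    (S T : Set P) (hS : ∀ p ∈ S, ∀ r, (p, r) ∉ M)
    (Ps : Finset (List (P ⊕ F))) (hPs : Feasible E M S T Ps)
    (hnotopt : Ps.card < fM E M S T) :
    ∃ l : List (P ⊕ F),
      IsDirPath (DirAdj E (symmDiffMatch M Ps)) l ∧
      startsIn (S \ srcOf Ps) l ∧ endsIn (T \ sinkOf Ps) l ∧
      ∃ Ps' : Finset (List (P ⊕ F)),
        Feasible E M S T Ps' ∧
        Ps'.card = Ps.card + 1 ∧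
        srcOf Ps' = srcOf Ps ∪ {p | l.head? = some (Sum.inl p)} ∧
        sinkOf Ps' = sinkOf Ps ∪ {q | l.getLast? = some (Sum.inl q)} ∧
        (∀ x : P ⊕ F, (∃ m ∈ Ps', x ∈ m) → (∃ m ∈ Ps, x ∈ m) ∨ x ∈ l) := by
  obtain ⟨l, a, b, hc, hn, hha, hlb, ha, hb⟩ :=
    PathAugmentation.exists_augmenting_path hM.1 hPs hnotopt
  have hsrc : {p | l.head? = some (Sum.inl p)} = {a} := by
    ext p
    simp [hha, eq_comm]
  have hsink : {q | l.getLast? = some (Sum.inl q)} = {b} := by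
    ext q
    simp [hlb, eq_comm]
  have hbal := (PathAugmentation.balanced_of_feasible hM.1 hS hPs).flip hc hn hha hlb
    (hS a ha.1) ha.2 (N' := symmDiffMatch (symmDiffMatch M Ps) {l})
    fun p r => by simp [PathAugmentation.mem_symmDiffMatch (Ps := {l})]
  have hS' : srcOf Ps ⊆ S := by
    rintro p ⟨m, hm, hp⟩
    obtain ⟨q, hq, hq'⟩ := hPs.2.1 m hm
    obtain rfl : q = p := by simpa [hp, eq_comm] using hq'
    exact hq
  have hT' : sinkOf Ps ⊆ T := by
    rintro p ⟨m, hm, hp⟩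
    obtain ⟨q, hq, hq'⟩ := hPs.2.2.1 m hm
    obtain rfl : q = p := by simpa [hp, eq_comm] using hq'
    exact hq
  obtain ⟨Ps', hf, hsrc', hsink', hvert⟩ := hbal.exists_feasible hM.1
    (Set.insert_subset ha.1 hS') (Set.insert_subset hb.1 hT')
  have hcard : Ps'.card = Ps.card + 1 := by
    rw [← PathAugmentation.ncard_srcOf hf, ← PathAugmentation.ncard_srcOf hPs, hsrc',
      Set.ncard_insert_of_notMem ha.2]
  refine ⟨l, ⟨fun h => by simp [h] at hha, hc, hn⟩, ⟨a, ha, hha⟩, ⟨b, hb, hlb⟩, Ps', hf, hcard,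
    ?_, ?_, ?_⟩
  · rw [hsrc, Set.union_singleton, hsrc']
  · rw [hsink, Set.union_singleton]
    refine Set.eq_of_subset_of_ncard_le hsink' ?_
    rw [Set.ncard_insert_of_notMem hb.2, PathAugmentation.ncard_sinkOf hf,
      PathAugmentation.ncard_sinkOf hPs, hcard]
  · rintro x ⟨m, hm, hx⟩
    rcases hvert m hm x hx with ⟨p, rfl | ⟨k, hk, hp⟩, rfl⟩ | ⟨p, r, hpr, hxpr⟩
    · exact .inr (List.mem_of_head? hha)
    · exact .inl ⟨k, hk, List.mem_of_head? hp⟩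
    · have hused : (∃ k ∈ Ps, usesEdge k p r) ∨ usesEdge l p r := by
        rw [PathAugmentation.mem_symmDiffMatch, PathAugmentation.mem_symmDiffMatch] at hpr
        simp only [Finset.mem_singleton, exists_eq_left] at hpr
        grind
      rcases hused with ⟨k, hk, hu⟩ | hu
      · have := PathAugmentation.usesEdge_mem hu
        exact .inl ⟨k, hk, by rcases hxpr with rfl | rfl <;> tauto⟩
      · have := PathAugmentation.usesEdge_mem hu
        exact .inr (by rcases hxpr with rfl | rfl <;> tauto)
end
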